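/- arXiv:math/9902146 — 2 statements merged into one kernel-verified Lean document; each statement's English description precedes it below -/
import Mathlib

section
/- The products Y·x₁^{s₁}⋯x_n^{s_n}, where Y ranges over a linear basis of the Sergeev algebra H_n and s₁,…,s_n range over non-negative integers, form a linear basis of the degenerate affine Sergeev algebra A_n. In particular, A_n is a free module over the polynomial algebra ℂ[x₁,…,x_n] with basis H_n. -/
open Equiv

/-- Generators of the degenerate affine Sergeev algebra `A_n`: the group elements
`w σ` (`σ ∈ S_n`), the Clifford generators `c p`, and the polynomial generators `x p`. -/
inductive SGen (n : ℕ) where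
  | w (σ : Equiv.Perm (Fin n)) : SGen n
  | c (p : Fin n) : SGen n
  | x (p : Fin n) : SGen n

namespace SGen

/-- The free algebra on the generators. -/
abbrev F (n : ℕ) := FreeAlgebra ℂ (SGen n)

/-- Canonical image of a generator in the free algebra. -/
noncomputable def g {n : ℕ} (a : SGen n) : F n := FreeAlgebra.ι ℂ a

/-- The defining relations of the degenerate affine Sergeev algebra `A_n`. -/
inductive Rel (n : ℕ) : F n → F n → Prop where
  | w_mul (σ τ : Equiv.Perm (Fin n)) : Rel n (g (w σ) * g (w τ)) (g (w (σ * τ)))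
  | w_one : Rel n (g (w (1 : Equiv.Perm (Fin n)))) 1
  | c_sq (p : Fin n) : Rel n (g (c p) * g (c p)) (-1)
  | c_anticomm (p q : Fin n) (h : p ≠ q) :
      Rel n (g (c p) * g (c q)) (-(g (c q) * g (c p)))
  | w_c (σ : Equiv.Perm (Fin n)) (p : Fin n) :
      Rel n (g (w σ) * g (c p)) (g (c (σ p)) * g (w σ))
  | x_comm (p q : Fin n) : Rel n (g (x p) * g (x q)) (g (x q) * g (x p))
  | x_w (p q qs : Fin n) (h : (qs : ℕ) = (q : ℕ) + 1) (h1 : p ≠ q) (h2 : p ≠ qs) :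
      Rel n (g (x p) * g (w (Equiv.swap q qs))) (g (w (Equiv.swap q qs)) * g (x p))
  | x_w_adj (p ps : Fin n) (h : (ps : ℕ) = (p : ℕ) + 1) :
      Rel n (g (x p) * g (w (Equiv.swap p ps)))
        (g (w (Equiv.swap p ps)) * g (x ps) - 1 - g (c p) * g (c ps))
  | x_c (p q : Fin n) (h : p ≠ q) : Rel n (g (x p) * g (c q)) (g (c q) * g (x p))
  | x_c_self (p : Fin n) : Rel n (g (x p) * g (c p)) (-(g (c p) * g (x p)))

end SGen

/-- The degenerate affine Sergeev algebra `A_n`. -/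
noncomputable abbrev AffineSergeev (n : ℕ) := RingQuot (SGen.Rel n)

/-- The image of the group element `w σ` in `A_n`. -/
noncomputable def Wq {n : ℕ} (σ : Equiv.Perm (Fin n)) : AffineSergeev n :=
  RingQuot.mkAlgHom ℂ (SGen.Rel n) (SGen.g (SGen.w σ))

/-- The image of the Clifford generator `c p` in `A_n`. -/
noncomputable def Cq {n : ℕ} (p : Fin n) : AffineSergeev n :=
  RingQuot.mkAlgHom ℂ (SGen.Rel n) (SGen.g (SGen.c p))

/-- The image of the generator `x p` in `A_n`. -/
noncomputable def Xq {n : ℕ} (p : Fin n) : AffineSergeev n :=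
  RingQuot.mkAlgHom ℂ (SGen.Rel n) (SGen.g (SGen.x p))

/-- The family of products `Y·x₁^{s₁}…x_n^{s_n}`, where `Y = c^{a}·w` runs through the
standard linear basis of the Sergeev algebra `H_n` (ordered products of distinct Clifford
generators times a permutation) and `s₁,…,s_n` through the non-negative integers. -/
noncomputable def basisFam (n : ℕ) :
    ((Fin n → Bool) × Equiv.Perm (Fin n) × (Fin n → ℕ)) → AffineSergeev n :=
  fun t =>
    ((List.finRange n).map fun p => if t.1 p then Cq p else 1).prod * Wq t.2.1 *
      ((List.finRange n).map fun p => Xq p ^ t.2.2 p).prod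

/-! ### Abstract relations -/

/-- Adjacent transposition induction. -/
theorem permAdjInduction (n : ℕ) {M : Equiv.Perm (Fin n) → Prop} (one : M 1)
    (step : ∀ p ps : Fin n, (ps : ℕ) = p + 1 → ∀ σ, M σ → M (Equiv.swap p ps * σ)) :
    ∀ σ, M σ := by
  intro σ
  rcases n with _ | n
  · rwa [Subsingleton.elim σ 1]
  · have h : σ ∈ Submonoid.closure (Set.range fun i : Fin n => Equiv.swap i.castSucc i.succ) := by
      rw [Equiv.Perm.mclosure_swap_castSucc_succ]; trivial
    induction h using Submonoid.closure_induction_left with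
    | one => exact one
    | mul_left x hx y hy ih =>
      obtain ⟨i, rfl⟩ := hx
      exact step _ _ (by simp) _ ih

/-- The relations of the Sergeev algebra. -/
structure Serg (n : ℕ) {R : Type*} [Ring R] (W : Equiv.Perm (Fin n) → R) (C : Fin n → R) : Prop where
  w_mul : ∀ σ τ, W σ * W τ = W (σ * τ)
  w_one : W 1 = 1
  c_sq : ∀ p, C p * C p = -1
  c_anti : ∀ p q, p ≠ q → C p * C q = -(C q * C p)
  w_c : ∀ σ p, W σ * C p = C (σ p) * W σ

/-- The relations of the affine Sergeev algebra except for commutativity of the `X`. -/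
structure SergX (n : ℕ) {R : Type*} [Ring R] (W : Equiv.Perm (Fin n) → R) (C X : Fin n → R) : Prop
    extends Serg n W C where
  x_w : ∀ p q qs : Fin n, (qs : ℕ) = q + 1 → p ≠ q → p ≠ qs →
    X p * W (Equiv.swap q qs) = W (Equiv.swap q qs) * X p
  x_w_adj : ∀ p ps : Fin n, (ps : ℕ) = p + 1 →
    X p * W (Equiv.swap p ps) = W (Equiv.swap p ps) * X ps - 1 - C p * C ps
  x_c : ∀ p q, p ≠ q → X p * C q = C q * X p
  x_c_self : ∀ p, X p * C p = -(C p * X p)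

section abs
variable {n : ℕ} {R : Type*} [Ring R] {W : Equiv.Perm (Fin n) → R} {C X Z : Fin n → R}

theorem adj_ne {p ps : Fin n} (h : (ps : ℕ) = p + 1) : p ≠ ps := by
  rintro rfl; omega

theorem Serg.w_sq (H : Serg n W C) (p q : Fin n) :
    W (Equiv.swap p q) * W (Equiv.swap p q) = 1 := by
  rw [H.w_mul, Equiv.swap_mul_self, H.w_one]

theorem SergX.x_w_adj' (H : SergX n W C X) (p ps : Fin n) (h : (ps : ℕ) = p + 1) :
    X ps * W (Equiv.swap p ps) = W (Equiv.swap p ps) * X p + 1 - C p * C ps := by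
  have h1 := H.x_w_adj p ps h
  set w := W (Equiv.swap p ps) with hw
  have hww : w * w = 1 := H.w_sq p ps
  have hc : w * (C p * C ps) * w = - (C p * C ps) := by
    rw [← mul_assoc, hw, H.w_c, mul_assoc (C _), H.w_c, ← hw, mul_assoc, mul_assoc, hww]
    simp only [Equiv.swap_apply_left, Equiv.swap_apply_right, mul_one]
    exact H.c_anti _ _ (adj_ne h).symm
  have h2 : w * (X p * w) * w = w * (w * X ps - 1 - C p * C ps) * w := by rw [h1]
  have h3 : w * (X p * w) * w = w * X p := by
    rw [mul_assoc, mul_assoc, hww, mul_one]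
  have h4 : w * (w * X ps - 1 - C p * C ps) * w = X ps * w - 1 - w * (C p * C ps) * w := by
    rw [mul_sub, mul_sub, ← mul_assoc, hww, sub_mul, sub_mul, mul_one, hww, one_mul]
  rw [h3, h4, hc] at h2
  rw [h2]; abel

/-- The commutator is moved through adjacent transpositions. -/
theorem SergX.comm_w (H : SergX n W C X) (i i' : Fin n) (h : (i' : ℕ) = i + 1) (p r : Fin n) :
    (X p * X r - X r * X p) * W (Equiv.swap i i') =
      W (Equiv.swap i i') * (X (Equiv.swap i i' p) * X (Equiv.swap i i' r)
        - X (Equiv.swap i i' r) * X (Equiv.swap i i' p)) := by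
  have h1 := H.x_w_adj i i' h
  have h2 := H.x_w_adj' i i' h
  have h3 : ∀ p, p ≠ i → p ≠ i' → _ := fun p => H.x_w p i i' h
  have hne := adj_ne h
  have hcc : ∀ p, p ≠ i → p ≠ i' → X p * (C i * C i') = C i * C i' * X p := by
    intro p hp hp'
    rw [← mul_assoc, H.x_c _ _ hp, mul_assoc, H.x_c _ _ hp', mul_assoc]
  have hci : X i * (C i * C i') = - (C i * C i' * X i) := by
    rw [← mul_assoc, H.x_c_self, neg_mul, mul_assoc, H.x_c _ _ hne, mul_assoc]
  have hci' : X i' * (C i * C i') = - (C i * C i' * X i') := by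
    rw [← mul_assoc, H.x_c _ _ hne.symm, mul_assoc, H.x_c_self, mul_neg, mul_assoc]
  set w := W (Equiv.swap i i') with hw
  set k := C i * C i' with hk
  have key : ∀ a b a' b' η θ : R, a * w = w * a' + η → b * w = w * b' + θ →
      η * b' + a * θ - θ * a' - b * η = 0 → (a * b - b * a) * w = w * (a' * b' - b' * a') := by
    intro a b a' b' η θ ha hb h0
    have e : (a * b - b * a) * w = w * (a' * b' - b' * a') + (η * b' + a * θ - θ * a' - b * η) := by
      rw [sub_mul, mul_assoc, hb, mul_assoc b, ha, mul_add, mul_add, ← mul_assoc, ha, ← mul_assoc,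
        hb]
      noncomm_ring
    rw [e, h0, add_zero]
  by_cases hp : p = i
  · subst hp
    by_cases hr : r = p
    · subst hr; simp
    by_cases hr' : r = i'
    · subst hr'
      rw [Equiv.swap_apply_left, Equiv.swap_apply_right]
      refine key _ _ _ _ (-1 - k) (1 - k) (by rw [h1]; abel) (by rw [h2]; abel) ?_
      rw [mul_sub, mul_sub, hci, hci']; noncomm_ring
    · rw [Equiv.swap_apply_left, Equiv.swap_apply_of_ne_of_ne hr hr']
      refine key _ _ _ _ (-1 - k) 0 (by rw [h1]; abel) (by rw [h3 r hr hr', add_zero]) ?_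
      rw [mul_sub, hcc r hr hr']; noncomm_ring
  by_cases hp' : p = i'
  · subst hp'
    by_cases hr : r = p
    · subst hr; simp
    by_cases hr' : r = i
    · subst hr'
      rw [Equiv.swap_apply_left, Equiv.swap_apply_right]
      refine key _ _ _ _ (1 - k) (-1 - k) (by rw [h2]; abel) (by rw [h1]; abel) ?_
      rw [mul_sub, mul_sub, hci, hci']; noncomm_ring
    · rw [Equiv.swap_apply_right, Equiv.swap_apply_of_ne_of_ne hr' hr]
      refine key _ _ _ _ (1 - k) 0 (by rw [h2]; abel) (by rw [h3 r hr' hr, add_zero]) ?_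
      rw [mul_sub, hcc r hr' hr]; noncomm_ring
  rw [Equiv.swap_apply_of_ne_of_ne hp hp']
  by_cases hr : r = i
  · subst hr
    rw [Equiv.swap_apply_left]
    refine key _ _ _ _ 0 (-1 - k) (by rw [h3 p hp hp', add_zero]) (by rw [h1]; abel) ?_
    rw [mul_sub, hcc p hp hp']; noncomm_ring
  by_cases hr' : r = i'
  · subst hr'
    rw [Equiv.swap_apply_right]
    refine key _ _ _ _ 0 (1 - k) (by rw [h3 p hp hp', add_zero]) (by rw [h2]; abel) ?_
    rw [mul_sub, hcc p hp hp']; noncomm_ring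
  rw [Equiv.swap_apply_of_ne_of_ne hr hr']
  refine key _ _ _ _ 0 0 (by rw [h3 p hp hp', add_zero]) (by rw [h3 r hr hr', add_zero]) ?_
  simp

theorem SergX.comm_c (H : SergX n W C X) (p r q : Fin n) :
    ∃ ε : R, (ε = 1 ∨ ε = -1) ∧ 
    (X p * X r - X r * X p) * C q = ε * C q * (X p * X r - X r * X p) := by
  have h : ∀ p, ∃ ε : R, (ε = 1 ∨ ε = -1) ∧ X p * C q = ε * C q * X p := by
    intro p
    by_cases hp : p = q
    · subst hp; exact ⟨-1, Or.inr rfl, by rw [H.x_c_self]; noncomm_ring⟩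
    · exact ⟨1, Or.inl rfl, by rw [H.x_c _ _ hp, one_mul]⟩
  obtain ⟨a, ha, hpa⟩ := h p
  obtain ⟨b, hb, hpb⟩ := h r
  refine ⟨a * b, ?_, ?_⟩
  · rcases ha with rfl | rfl <;> rcases hb with rfl | rfl <;> simp
  · rw [sub_mul, mul_assoc, hpb, mul_assoc (X r), hpa]
    rcases ha with rfl | rfl <;> rcases hb with rfl | rfl <;>
      simp only [one_mul, neg_mul, mul_neg, neg_neg, mul_one, mul_sub] at * <;>
      rw [← mul_assoc (X p), ← mul_assoc (X r), hpa, hpb] <;> noncomm_ring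

/-- The elementary summand of the Jucys-Murphy elements. -/
def jmT (W : Equiv.Perm (Fin n) → R) (C : Fin n → R) (q p : Fin n) : R :=
  W (Equiv.swap q p) * (1 + C q * C p)

/-- Jucys-Murphy elements. -/
def jm (W : Equiv.Perm (Fin n) → R) (C : Fin n → R) (p : Fin n) : R :=
  ∑ q ∈ Finset.Iio p, jmT W C q p

theorem Serg.w_jmT (H : Serg n W C) (τ : Equiv.Perm (Fin n)) (q p : Fin n) :
    W τ * jmT W C q p = jmT W C (τ q) (τ p) * W τ := by
  unfold jmT
  rw [← mul_assoc, H.w_mul, Equiv.mul_swap_eq_swap_mul, ← H.w_mul, mul_assoc, mul_assoc]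
  congr 1
  rw [mul_add, add_mul, mul_one, one_mul, ← mul_assoc, H.w_c, mul_assoc, H.w_c, mul_assoc]

theorem Serg.jmT_c (H : Serg n W C) (q p r : Fin n) (hqp : q ≠ p) (hr : r ≠ p) :
    jmT W C q p * C r = C r * jmT W C q p := by
  unfold jmT
  have h1 : W (Equiv.swap q p) * C (Equiv.swap q p r) = C r * W (Equiv.swap q p) := by
    rw [H.w_c]; simp
  rw [← mul_assoc, ← h1, mul_assoc, mul_assoc]
  congr 1
  by_cases hrq : r = q
  · subst hrq
    rw [Equiv.swap_apply_left, add_mul, mul_add, H.c_anti r p hqp, neg_mul, mul_assoc, H.c_sq,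
      mul_neg, mul_neg (C p) (C p * C r), ← mul_assoc, H.c_sq]
    simp [add_comm]
  · rw [Equiv.swap_apply_of_ne_of_ne hrq hr, add_mul, mul_add, mul_assoc, H.c_anti p r hr.symm,
      mul_neg, ← mul_assoc, H.c_anti q r (Ne.symm hrq)]
    noncomm_ring

theorem Serg.jmT_c_self (H : Serg n W C) (q p : Fin n) :
    jmT W C q p * C p = - (C p * jmT W C q p) := by
  unfold jmT
  have h1 : W (Equiv.swap q p) * C q = C p * W (Equiv.swap q p) := by
    rw [H.w_c]; simp
  rw [← mul_assoc, ← h1, mul_assoc, mul_assoc, ← mul_neg]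
  congr 1
  rw [add_mul, mul_add, mul_assoc, H.c_sq, ← mul_assoc (C q) (C q), H.c_sq]
  noncomm_ring

/-- The main abstract lemma : Jucys-Murphy elements plus an equivariant family. -/
theorem Serg.sergX (H : Serg n W C) (hw : ∀ τ p, W τ * Z p = Z (τ p) * W τ)
    (hc : ∀ p q, p ≠ q → Z p * C q = C q * Z p) (hcs : ∀ p, Z p * C p = -(C p * Z p)) :
    SergX n W C (fun p => jm W C p + Z p) where
  toSerg := H
  x_w p q qs h h1 h2 := by
    have hp : Equiv.swap q qs p = p := Equiv.swap_apply_of_ne_of_ne h1 h2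
    rw [add_mul, mul_add, hw, hp]
    congr 1
    unfold jm
    rw [Finset.mul_sum, Finset.sum_mul]
    symm
    refine Finset.sum_equiv (Equiv.swap q qs) ?_ ?_
    · intro i
      simp only [Finset.mem_Iio, Equiv.swap_apply_def, Fin.lt_def, Fin.ext_iff, ne_eq] at *
      split_ifs <;> omega
    · intro i _
      rw [H.w_jmT, hp]
  x_w_adj p ps h := by
    have hI : Finset.Iio ps = insert p (Finset.Iio p) := by
      ext i; simp only [Finset.mem_Iio, Finset.mem_insert, Fin.lt_def, Fin.ext_iff]; omega
    have hne := adj_ne h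
    rw [add_mul, mul_add, hw, Equiv.swap_apply_right]
    have : jm W C p * W (Equiv.swap p ps) = W (Equiv.swap p ps) * jm W C ps - 1 - C p * C ps := by
      unfold jm
      rw [hI, Finset.sum_insert (by simp), mul_add, Finset.mul_sum, Finset.sum_mul]
      have e1 : W (Equiv.swap p ps) * jmT W C p ps = 1 + C p * C ps := by
        unfold jmT
        rw [← mul_assoc, H.w_sq, one_mul]
      have e2 : ∀ i ∈ Finset.Iio p, W (Equiv.swap p ps) * jmT W C i ps
          = jmT W C i p * W (Equiv.swap p ps) := by
        intro i hi
        simp only [Finset.mem_Iio, Fin.lt_def] at hi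
        rw [H.w_jmT, Equiv.swap_apply_right, Equiv.swap_apply_of_ne_of_ne]
        · rintro rfl; omega
        · rintro rfl; omega
      rw [Finset.sum_congr rfl e2, e1]; abel
    rw [this]; abel
  x_c p q h := by
    rw [add_mul, mul_add, hc _ _ h]
    congr 1
    unfold jm
    rw [Finset.mul_sum, Finset.sum_mul]
    exact Finset.sum_congr rfl fun i hi => H.jmT_c _ _ _ (Finset.mem_Iio.1 hi).ne (Ne.symm h)
  x_c_self p := by
    rw [add_mul, mul_add, hcs, neg_add]
    congr 1
    unfold jm
    rw [Finset.mul_sum, Finset.sum_mul, ← Finset.sum_neg_distrib]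
    exact Finset.sum_congr rfl fun i _ => H.jmT_c_self _ _

end abs
/-! ### The module -/

/-- Polynomials. -/
abbrev SP (n : ℕ) := MvPolynomial (Fin n) ℂ

/-- The quadratic form `-∑ mᵢ²`. -/
noncomputable def SQ (n : ℕ) : QuadraticForm (SP n) (Fin n → SP n) :=
  QuadraticMap.weightedSumSquares (SP n) (fun _ : Fin n => (-1 : SP n))

/-- The Clifford algebra over polynomials. -/
abbrev SCl (n : ℕ) := CliffordAlgebra (SQ n)

/-- Clifford generators. -/
noncomputable def ge {n : ℕ} (p : Fin n) : SCl n := CliffordAlgebra.ι (SQ n) (Pi.single p 1)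

theorem SQ_apply {n : ℕ} (m : Fin n → SP n) : SQ n m = ∑ i, -(m i * m i) := by
  simp [SQ, QuadraticMap.weightedSumSquares_apply]

theorem ge_sq {n : ℕ} (p : Fin n) : ge p * ge p = -1 := by
  unfold ge
  rw [CliffordAlgebra.ι_sq_scalar, SQ_apply, Finset.sum_eq_single p]
  · simp
  · intro b _ hb; simp [hb]
  · simp

theorem ge_anti {n : ℕ} (p q : Fin n) (h : p ≠ q) : ge p * ge q = -(ge q * ge p) := by
  unfold ge
  rw [eq_neg_iff_add_eq_zero, CliffordAlgebra.ι_mul_ι_add_swap]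
  have : QuadraticMap.polar (SQ n) (Pi.single p 1) (Pi.single q 1) = 0 := by
    unfold QuadraticMap.polar
    rw [SQ_apply, SQ_apply, SQ_apply, ← Finset.sum_sub_distrib, ← Finset.sum_sub_distrib]
    refine Finset.sum_eq_zero fun i _ => ?_
    by_cases hp : i = p
    · subst hp; simp [h]
    · simp [hp]
  rw [this, map_zero]

theorem SCl_ext {n : ℕ} {A : Type*} [Semiring A] [Algebra (SP n) A] {f g : SCl n →ₐ[SP n] A}
    (h : ∀ p, f (ge p) = g (ge p)) : f = g := by
  apply CliffordAlgebra.hom_ext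
  apply LinearMap.pi_ext'
  intro p
  ext
  exact h p

/-- Permutation isometry. -/
noncomputable def permIso {n : ℕ} (τ : Equiv.Perm (Fin n)) : SQ n →qᵢ SQ n where
  toLinearMap := LinearMap.funLeft (SP n) (SP n) (τ⁻¹ : Equiv.Perm (Fin n))
  map_app' m := by
    simp only [SQ_apply]
    exact Equiv.sum_comp (τ⁻¹ : Equiv.Perm (Fin n)) (fun i => -(m i * m i))

/-- Permutation automorphism. -/
noncomputable def permA {n : ℕ} (τ : Equiv.Perm (Fin n)) : SCl n →ₐ[SP n] SCl n :=
  CliffordAlgebra.map (permIso τ)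

theorem permA_ge {n : ℕ} (τ : Equiv.Perm (Fin n)) (p : Fin n) : permA τ (ge p) = ge (τ p) := by
  unfold permA ge
  rw [CliffordAlgebra.map_apply_ι]
  congr 1
  funext i
  change (Pi.single p 1 : Fin n → SP n) (τ⁻¹ i) = _
  rw [Pi.single_apply, Pi.single_apply]
  simp only [Equiv.Perm.inv_eq_iff_eq]

/-- Sign isometry. -/
noncomputable def sgnIso {n : ℕ} (p : Fin n) : SQ n →qᵢ SQ n where
  toLinearMap := LinearMap.pi fun i => (if i = p then (-1 : SP n) else 1) • LinearMap.proj i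
  map_app' m := by
    change SQ n (fun i => (if i = p then (-1 : SP n) else 1) * m i) = _
    rw [SQ_apply, SQ_apply]
    refine Finset.sum_congr rfl fun i _ => ?_
    split_ifs <;> ring

/-- Sign automorphism. -/
noncomputable def sgnA {n : ℕ} (p : Fin n) : SCl n →ₐ[SP n] SCl n :=
  CliffordAlgebra.map (sgnIso p)

theorem sgnA_ge {n : ℕ} (p q : Fin n) : sgnA p (ge q) = if q = p then - ge q else ge q := by
  unfold sgnA ge
  rw [CliffordAlgebra.map_apply_ι]
  have : sgnIso p (Pi.single q 1) = (if q = p then (-1 : SP n) else 1) • Pi.single q 1 := by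
    funext i
    change (if i = p then (-1 : SP n) else 1) * (Pi.single q 1 : Fin n → SP n) i = _
    by_cases h : i = q
    · subst h; simp
    · simp [h]
  rw [this]
  split_ifs <;> simp

theorem permA_mul {n : ℕ} (σ τ : Equiv.Perm (Fin n)) (x : SCl n) :
    permA σ (permA τ x) = permA (σ * τ) x := by
  have : (permA σ).comp (permA τ) = permA (σ * τ) := by
    apply SCl_ext; intro p; simp [permA_ge]
  exact DFunLike.congr_fun this x

theorem permA_one {n : ℕ} (x : SCl n) : permA 1 x = x := by
  have : permA (1 : Equiv.Perm (Fin n)) = AlgHom.id (SP n) (SCl n) := by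
    apply SCl_ext; intro p; simp [permA_ge]
  exact DFunLike.congr_fun this x

theorem permA_sgnA {n : ℕ} (τ : Equiv.Perm (Fin n)) (p : Fin n) (x : SCl n) :
    permA τ (sgnA p x) = sgnA (τ p) (permA τ x) := by
  have : (permA τ).comp (sgnA p) = (sgnA (τ p)).comp (permA τ) := by
    apply SCl_ext; intro q
    simp only [AlgHom.comp_apply, permA_ge, sgnA_ge, EmbeddingLike.apply_eq_iff_eq]
    split_ifs <;> simp [permA_ge]
  exact DFunLike.congr_fun this x

/-- The module. -/
abbrev SV (n : ℕ) := Equiv.Perm (Fin n) → SCl n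

/-- Its endomorphisms. -/
abbrev SE (n : ℕ) := Module.End (SP n) (SV n)

/-- Left multiplication by permutations. -/
noncomputable def opW {n : ℕ} (τ : Equiv.Perm (Fin n)) : SE n where
  toFun v ρ := permA τ (v (τ⁻¹ * ρ))
  map_add' v w := by funext ρ; simp
  map_smul' f v := by funext ρ; simp

/-- Left multiplication by Clifford generators. -/
noncomputable def opC {n : ℕ} (p : Fin n) : SE n where
  toFun v ρ := ge p * v ρ
  map_add' v w := by funext ρ; simp [mul_add]
  map_smul' f v := by funext ρ; simp

/-- Right multiplication by a permutation (inverse). -/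
noncomputable def rW {n : ℕ} (τ : Equiv.Perm (Fin n)) : SE n where
  toFun v ρ := v (ρ * τ⁻¹)
  map_add' v w := by funext ρ; simp
  map_smul' f v := by funext ρ; simp

/-- Right multiplication by Clifford generators. -/
noncomputable def rC {n : ℕ} (p : Fin n) : SE n where
  toFun v ρ := v ρ * ge (ρ p)
  map_add' v w := by funext ρ; simp [add_mul]
  map_smul' f v := by funext ρ; simp

/-- Twisted projections. -/
noncomputable def opT {n : ℕ} (p q : Fin n) : SE n where
  toFun v ρ := if ρ q = p then sgnA p (v ρ) else 0
  map_add' v w := by funext ρ; simp only [Pi.add_apply, map_add]; split_ifs <;> simp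
  map_smul' f v := by
    funext ρ; simp only [Pi.smul_apply, map_smul, RingHom.id_apply]; split_ifs <;> simp

theorem opSerg (n : ℕ) : Serg n (opW (n := n)) opC where
  w_mul σ τ := by
    refine LinearMap.ext fun v => funext fun ρ => ?_
    simp only [opW, Module.End.mul_apply, LinearMap.coe_mk, AddHom.coe_mk, permA_mul,
      mul_inv_rev, mul_assoc]
  w_one := by
    refine LinearMap.ext fun v => funext fun ρ => ?_
    simp [opW, permA_one]
  c_sq p := by
    refine LinearMap.ext fun v => funext fun ρ => ?_
    simp [opC, ← mul_assoc, ge_sq]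
  c_anti p q h := by
    refine LinearMap.ext fun v => funext fun ρ => ?_
    simp [opC, ← mul_assoc, ge_anti p q h]
  w_c σ p := by
    refine LinearMap.ext fun v => funext fun ρ => ?_
    simp [opC, opW, permA_ge]

theorem opW_rW {n : ℕ} (σ τ : Equiv.Perm (Fin n)) : Commute (opW σ) (rW τ) := by
  ext v ρ; simp [opW, rW, mul_assoc]

theorem opW_rC {n : ℕ} (σ : Equiv.Perm (Fin n)) (p : Fin n) : Commute (opW σ) (rC p) := by
  ext v ρ; simp [opW, rC, permA_ge]

theorem opC_rW {n : ℕ} (p : Fin n) (τ : Equiv.Perm (Fin n)) : Commute (opC p) (rW τ) := by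
  ext v ρ; simp [opC, rW]

theorem opC_rC {n : ℕ} (q : Fin n) (p : Fin n) : Commute (opC q) (rC p) := by
  ext v ρ; simp [opC, rC, mul_assoc]

theorem opW_opT {n : ℕ} (τ : Equiv.Perm (Fin n)) (p q : Fin n) :
    opW τ * opT p q = opT (τ p) q * opW τ := by
  refine LinearMap.ext fun v => funext fun ρ => ?_
  simp only [opW, opT, Module.End.mul_apply, LinearMap.coe_mk, AddHom.coe_mk, 
    Equiv.Perm.mul_apply, Equiv.Perm.inv_eq_iff_eq]
  split_ifs <;> simp [permA_sgnA]

theorem opT_opC {n : ℕ} (p q r : Fin n) (h : p ≠ r) :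
    opT p q * opC r = opC r * opT p q := by
  refine LinearMap.ext fun v => funext fun ρ => ?_
  simp only [opC, opT, Module.End.mul_apply, LinearMap.coe_mk, AddHom.coe_mk]
  split_ifs <;> simp [sgnA_ge, h.symm]

theorem opT_opC_self {n : ℕ} (p q : Fin n) :
    opT p q * opC p = -(opC p * opT p q) := by
  refine LinearMap.ext fun v => funext fun ρ => ?_
  simp only [opC, opT, Module.End.mul_apply, LinearMap.coe_mk, AddHom.coe_mk, LinearMap.neg_apply,
    Pi.neg_apply]
  split_ifs <;> simp [sgnA_ge]

/-- Right multiplication by the Jucys-Murphy elements. -/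
noncomputable def rJ {n : ℕ} (q : Fin n) : SE n :=
  ∑ r ∈ Finset.Iio q, (1 + rC q * rC r) * rW (Equiv.swap r q)

/-- The right factor `x_q - J_q`. -/
noncomputable def rD {n : ℕ} (q : Fin n) : SE n :=
  algebraMap (SP n) (SE n) (MvPolynomial.X q) - rJ q

theorem commute_rD {n : ℕ} (a : SE n) (h1 : ∀ τ, Commute a (rW τ)) (h2 : ∀ p, Commute a (rC p))
    (q : Fin n) : Commute a (rD q) := by
  refine Commute.sub_right (Algebra.commute_algebraMap_right _ _) ?_
  refine Commute.sum_right _ _ _ fun r _ => ?_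
  exact ((Commute.one_right a).add_right ((h2 _).mul_right (h2 _))).mul_right (h1 _)

/-- The equivariant part of `x_p`. -/
noncomputable def opZ {n : ℕ} (p : Fin n) : SE n := ∑ q, rD q * opT p q

/-- The operator of `x_p`. -/
noncomputable def opX {n : ℕ} (p : Fin n) : SE n := jm opW opC p + opZ p

theorem opSergX (n : ℕ) : SergX n (opW (n := n)) opC opX := by
  have hW : ∀ (τ : Equiv.Perm (Fin n)) q, Commute (opW τ) (rD q) := fun τ q =>
    commute_rD _ (opW_rW τ) (opW_rC τ) q
  have hC : ∀ (r : Fin n) q, Commute (opC r) (rD q) := fun r q =>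
    commute_rD _ (opC_rW r) (opC_rC r) q
  refine (opSerg n).sergX ?_ ?_ ?_
  · intro τ p
    unfold opZ
    rw [Finset.mul_sum, Finset.sum_mul]
    refine Finset.sum_congr rfl fun q _ => ?_
    rw [← mul_assoc, (hW τ q).eq, mul_assoc, opW_opT, mul_assoc]
  · intro p r h
    unfold opZ
    rw [Finset.mul_sum, Finset.sum_mul]
    refine Finset.sum_congr rfl fun q _ => ?_
    rw [← mul_assoc, (hC r q).eq, mul_assoc, mul_assoc, opT_opC _ _ _ h]
  · intro p
    unfold opZ
    rw [Finset.mul_sum, Finset.sum_mul, ← Finset.sum_neg_distrib]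
    refine Finset.sum_congr rfl fun q _ => ?_
    rw [← mul_assoc, (hC p q).eq, mul_assoc, mul_assoc, opT_opC_self]
    exact mul_neg (rD q) (opC p * opT p q : SE n)

/-- The vacuum vector. -/
noncomputable def vac (n : ℕ) : SV n := Pi.single 1 1

theorem opW_vac {n : ℕ} (τ : Equiv.Perm (Fin n)) : opW τ (vac n) = Pi.single τ 1 := by
  funext ρ
  simp only [opW, vac, LinearMap.coe_mk, AddHom.coe_mk, Pi.single_apply, inv_mul_eq_one]
  by_cases h : ρ = τ
  · simp [h]
  · simp [h, Ne.symm h]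

theorem rW_vac {n : ℕ} (τ : Equiv.Perm (Fin n)) : rW τ (vac n) = opW τ (vac n) := by
  rw [opW_vac]
  funext ρ
  simp only [rW, vac, LinearMap.coe_mk, AddHom.coe_mk, Pi.single_apply, mul_inv_eq_one]

theorem rC_vac {n : ℕ} (p : Fin n) : rC p (vac n) = opC p (vac n) := by
  funext ρ
  simp only [rC, opC, vac, LinearMap.coe_mk, AddHom.coe_mk, Pi.single_apply]
  by_cases h : ρ = 1
  · simp [h]
  · simp [h]

theorem opT_vac {n : ℕ} (p q : Fin n) : opT p q (vac n) = if q = p then vac n else 0 := by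
  funext ρ
  simp only [opT, vac, LinearMap.coe_mk, AddHom.coe_mk, Pi.single_apply]
  by_cases h : ρ = 1
  · subst h
    by_cases hq : q = p <;> simp [hq]
  · by_cases hq : q = p <;> simp [h, hq]

theorem jm_vac {n : ℕ} (p : Fin n) : jm opW opC p (vac n) = rJ p (vac n) := by
  unfold jm rJ
  rw [LinearMap.sum_apply, LinearMap.sum_apply]
  refine Finset.sum_congr rfl fun q _ => ?_
  have hc : Commute (opW (Equiv.swap q p)) (1 + rC p * rC q) :=
    (Commute.one_right _).add_right ((opW_rC _ _).mul_right (opW_rC _ _))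
  unfold jmT
  rw [Module.End.mul_apply (1 + _), rW_vac, ← Module.End.mul_apply, ← hc.eq, Module.End.mul_apply,
    Module.End.mul_apply]
  congr 1
  rw [LinearMap.add_apply, LinearMap.add_apply, Module.End.mul_apply, Module.End.mul_apply, rC_vac,
    ← Module.End.mul_apply (rC p), ← (opC_rC q p).eq, Module.End.mul_apply, rC_vac]

theorem opX_vac {n : ℕ} (p : Fin n) :
    opX p (vac n) = (MvPolynomial.X p : SP n) • vac n := by
  unfold opX opZ
  rw [LinearMap.add_apply, jm_vac, LinearMap.sum_apply, Finset.sum_eq_single p]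
  · rw [Module.End.mul_apply, opT_vac, if_pos rfl, rD, LinearMap.sub_apply,
      Module.algebraMap_end_apply]
    abel
  · intro q _ hq
    rw [Module.End.mul_apply, opT_vac, if_neg hq, map_zero]
  · simp

theorem opX_comm {n : ℕ} (p r : Fin n) : opX p * opX r = opX r * (opX p : SE n) := by
  have H := opSergX n
  let N : Submodule (SP n) (SV n) := ⨅ p : Fin n, ⨅ r : Fin n,
    LinearMap.ker (opX p * opX r - opX r * opX p)
  have hN : ∀ v, v ∈ N ↔ ∀ p r, (opX p * opX r - opX r * opX p : SE n) v = 0 := by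
    intro v; simp only [N, Submodule.mem_iInf, LinearMap.mem_ker]
  have h1 : vac n ∈ N := by
    rw [hN]; intro p r
    rw [LinearMap.sub_apply, Module.End.mul_apply, Module.End.mul_apply, opX_vac, opX_vac, map_smul,
      map_smul, opX_vac, opX_vac, smul_comm, sub_self]
  have hC : ∀ q v, v ∈ N → opC q v ∈ N := by
    intro q v hv
    rw [hN] at hv ⊢
    intro p r
    obtain ⟨ε, -, h⟩ := H.comm_c p r q
    rw [← Module.End.mul_apply, h, Module.End.mul_apply, hv, map_zero]
  have hW : ∀ τ v, v ∈ N → opW τ v ∈ N := by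
    intro τ
    refine permAdjInduction n (M := fun τ => ∀ v, v ∈ N → opW τ v ∈ N) ?_ ?_ τ
    · intro v hv; rwa [H.w_one]
    · intro i i' hi σ ih v hv
      have h := ih v hv
      rw [← H.w_mul, Module.End.mul_apply]
      rw [hN] at h ⊢
      intro p r
      rw [← Module.End.mul_apply, H.comm_w i i' hi, Module.End.mul_apply, h, map_zero]
  have hCl : ∀ x : SCl n, (Pi.single 1 x : SV n) ∈ N := by
    intro x
    induction x using CliffordAlgebra.left_induction with
    | algebraMap r =>
      have : (Pi.single 1 (algebraMap (SP n) (SCl n) r) : SV n) = r • vac n := by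
        rw [vac, ← Pi.single_smul, Algebra.algebraMap_eq_smul_one]
      rw [this]; exact N.smul_mem _ h1
    | add x y hx hy => rw [Pi.single_add]; exact N.add_mem hx hy
    | ι_mul x m hx =>
      have : (Pi.single 1 (CliffordAlgebra.ι (SQ n) m * x) : SV n) =
          ∑ i, m i • opC i (Pi.single 1 x) := by
        have hm : m = ∑ i, m i • (Pi.single i 1 : Fin n → SP n) := by
          funext j; simp [Finset.sum_apply, Pi.single_apply]
        conv_lhs => rw [hm, map_sum, Finset.sum_mul]
        funext ρ
        rw [Finset.sum_apply]
        by_cases h : ρ = 1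
        · subst h; simp [opC, ge]
        · simp [h, opC]
      rw [this]
      exact N.sum_mem fun i _ => N.smul_mem _ (hC _ _ hx)
  have hσ : ∀ σ (x : SCl n), (Pi.single σ x : SV n) ∈ N := by
    intro σ x
    have : (Pi.single σ x : SV n) = opW σ (Pi.single 1 (permA σ⁻¹ x)) := by
      funext ρ
      simp only [opW, LinearMap.coe_mk, AddHom.coe_mk]
      by_cases h : ρ = σ
      · subst h; simp [permA_mul, permA_one]
      · rw [Pi.single_eq_of_ne h, Pi.single_eq_of_ne, map_zero]
        rw [Ne, inv_mul_eq_one]; exact Ne.symm h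
    rw [this]; exact hW _ _ (hCl _)
  apply LinearMap.ext
  intro v
  have hv : v ∈ N := by
    have : v = ∑ σ, Pi.single σ (v σ) := (Finset.univ_sum_single v).symm
    rw [this]; exact N.sum_mem fun σ _ => hσ _ _
  have := (hN v).1 hv p r
  rwa [LinearMap.sub_apply, sub_eq_zero] at this
/-! ### Linear independence -/

/-- Ordered Clifford monomials along a list. -/
noncomputable def clMono {n : ℕ} (l : List (Fin n)) (a : Fin n → Bool) : SCl n :=
  (l.map fun p => if a p then ge p else 1).prod

theorem contract_ge {n : ℕ} (p q : Fin n) (x : SCl n) :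
    CliffordAlgebra.contractLeft (LinearMap.proj p) (ge q * x) =
      (if p = q then x else 0) - ge q * CliffordAlgebra.contractLeft (LinearMap.proj p) x := by
  unfold ge
  rw [CliffordAlgebra.contractLeft_ι_mul]
  congr 1
  by_cases h : p = q
  · subst h; simp
  · simp [h]

theorem contract_clMono {n : ℕ} (p : Fin n) (l : List (Fin n)) (hp : p ∉ l) (a : Fin n → Bool) :
    CliffordAlgebra.contractLeft (LinearMap.proj p) (clMono l a) = 0 := by
  induction l with
  | nil => simp [clMono]
  | cons q l ih =>
    simp only [List.mem_cons, not_or] at hp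
    have e : clMono (q :: l) a = (if a q then ge q else 1) * clMono l a := by
      simp [clMono]
    rw [e]
    split_ifs
    · rw [contract_ge, ih hp.2, if_neg hp.1]; simp
    · rw [one_mul, ih hp.2]

theorem exists_functional {n : ℕ} (l : List (Fin n)) (hl : l.Nodup) (b : Fin n → Bool) :
    ∃ φ : SCl n →ₗ[SP n] SP n, ∀ a, φ (clMono l a) = if ∀ p ∈ l, a p = b p then 1 else 0 := by
  induction l with
  | nil =>
    letI : Invertible (2 : SP n) := by
      letI : Invertible (algebraMap ℂ (SP n) 2) := Invertible.map (algebraMap ℂ (SP n)) 2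
      exact this.copy _ (map_ofNat (algebraMap ℂ (SP n)) 2).symm
    refine ⟨(ExteriorAlgebra.algebraMapInv (R := SP n) (M := Fin n → SP n)).toLinearMap ∘ₗ
      (CliffordAlgebra.equivExterior (SQ n)).toLinearMap, fun a => ?_⟩
    simp [clMono, CliffordAlgebra.equivExterior]
  | cons q l ih =>
    rw [List.nodup_cons] at hl
    obtain ⟨φ, hφ⟩ := ih hl.2
    have e : ∀ a, clMono (q :: l) a = (if a q then ge q else 1) * clMono l a := by
      simp [clMono]
    by_cases hb : b q = true
    · refine ⟨φ ∘ₗ CliffordAlgebra.contractLeft (LinearMap.proj q), fun a => ?_⟩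
      rw [LinearMap.comp_apply, e]
      by_cases ha : a q = true
      · rw [if_pos ha, contract_ge, contract_clMono _ _ hl.1]
        simp [hφ, ha, hb]
      · rw [if_neg ha, one_mul, contract_clMono _ _ hl.1]
        simp [ha, hb]
    · refine ⟨φ ∘ₗ (LinearMap.id - LinearMap.mulLeft (SP n) (ge q) ∘ₗ
        CliffordAlgebra.contractLeft (LinearMap.proj q)), fun a => ?_⟩
      rw [LinearMap.comp_apply, e]
      by_cases ha : a q = true
      · rw [if_pos ha, LinearMap.sub_apply, LinearMap.comp_apply, contract_ge,
          contract_clMono _ _ hl.1]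
        simp [ha, hb]
      · rw [if_neg ha, one_mul, LinearMap.sub_apply, LinearMap.comp_apply,
          contract_clMono _ _ hl.1]
        simp [hφ, ha, hb]

/-- Assignment of operators to the generators. -/
noncomputable def opGen {n : ℕ} : SGen n → SE n
  | SGen.w σ => opW σ
  | SGen.c p => opC p
  | SGen.x p => opX p

/-- The representation. -/
noncomputable def rep (n : ℕ) : AffineSergeev n →ₐ[ℂ] SE n :=
  RingQuot.liftAlgHom ℂ ⟨FreeAlgebra.lift ℂ opGen, by
    have H := opSergX n
    intro x y h
    induction h with
    | w_mul σ τ => simpa [SGen.g, opGen] using H.w_mul σ τ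
    | w_one => simpa [SGen.g, opGen] using H.w_one
    | c_sq p => simpa [SGen.g, opGen] using H.c_sq p
    | c_anticomm p q h => simpa [SGen.g, opGen] using H.c_anti p q h
    | w_c σ p => simpa [SGen.g, opGen] using H.w_c σ p
    | x_comm p q => simpa [SGen.g, opGen] using opX_comm p q
    | x_w p q qs h h1 h2 => simpa [SGen.g, opGen] using H.x_w p q qs h h1 h2
    | x_w_adj p ps h => simpa [SGen.g, opGen] using H.x_w_adj p ps h
    | x_c p q h => simpa [SGen.g, opGen] using H.x_c p q h
    | x_c_self p => simpa [SGen.g, opGen] using H.x_c_self p⟩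

theorem rep_W {n : ℕ} (σ : Equiv.Perm (Fin n)) : rep n (Wq σ) = opW σ := by
  simp [rep, Wq, SGen.g, opGen]

theorem rep_C {n : ℕ} (p : Fin n) : rep n (Cq p) = opC p := by
  simp [rep, Cq, SGen.g, opGen]

theorem rep_X {n : ℕ} (p : Fin n) : rep n (Xq p) = opX p := by
  simp [rep, Xq, SGen.g, opGen]

theorem rep_xMono {n : ℕ} (l : List (Fin n)) (s : Fin n → ℕ) :
    rep n ((l.map fun p => Xq p ^ s p).prod) (vac n) =
      ((l.map fun p => (MvPolynomial.X p : SP n) ^ s p).prod) • vac n := by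
  have hp : ∀ p k, ((opX p : SE n) ^ k) (vac n) = (MvPolynomial.X p : SP n) ^ k • vac n := by
    intro p k
    induction k with
    | zero => simp
    | succ k ih =>
      rw [pow_succ, Module.End.mul_apply, opX_vac, map_smul, ih, smul_smul, pow_succ, mul_comm]
  induction l with
  | nil => simp
  | cons q l ih =>
    rw [List.map_cons, List.prod_cons, map_mul, Module.End.mul_apply, ih, map_smul, map_pow, rep_X,
      hp, smul_smul, List.map_cons, List.prod_cons, mul_comm]

theorem rep_cMono {n : ℕ} (l : List (Fin n)) (a : Fin n → Bool) (σ : Equiv.Perm (Fin n)) :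
    rep n ((l.map fun p => if a p then Cq p else 1).prod) (Pi.single σ 1) =
      Pi.single σ (clMono l a) := by
  have hc : ∀ p x, opC p (Pi.single σ x : SV n) = Pi.single σ (ge p * x) := by
    intro p x
    funext ρ
    by_cases h : ρ = σ
    · subst h; simp [opC]
    · simp [opC, h]
  induction l with
  | nil => simp [clMono]
  | cons q l ih =>
    rw [List.map_cons, List.prod_cons, map_mul, Module.End.mul_apply, ih]
    have e : clMono (q :: l) a = (if a q then ge q else 1) * clMono l a := by
      simp [clMono]
    rw [e]
    split_ifs
    · rw [rep_C, hc]
    · simp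

theorem prod_X_monomial {n : ℕ} (s : Fin n → ℕ) :
    ((List.finRange n).map fun p => (MvPolynomial.X p : SP n) ^ s p).prod =
      MvPolynomial.monomial (Finsupp.equivFunOnFinite.symm s) 1 := by
  rw [MvPolynomial.monomial_eq, ← List.ofFn_eq_map, List.prod_ofFn, Finsupp.prod_fintype]
  · simp
  · simp

theorem rep_basisFam {n : ℕ} (t : (Fin n → Bool) × Equiv.Perm (Fin n) × (Fin n → ℕ)) :
    rep n (basisFam n t) (vac n) =
      (MvPolynomial.monomial (Finsupp.equivFunOnFinite.symm t.2.2) 1 : SP n) •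
        (Pi.single t.2.1 (clMono (List.finRange n) t.1) : SV n) := by
  unfold basisFam
  rw [map_mul, map_mul, Module.End.mul_apply, rep_xMono, map_smul, Module.End.mul_apply, rep_W,
    opW_vac, rep_cMono, prod_X_monomial]

theorem basisFam_indep (n : ℕ) : LinearIndependent ℂ (basisFam n) := by
  choose φ hφ using exists_functional (List.finRange n) (List.nodup_finRange n)
  let ev : SE n →ₗ[ℂ] SV n :=
    { toFun := fun f => f (vac n)
      map_add' := fun _ _ => rfl
      map_smul' := fun _ _ => rfl }
  let F : AffineSergeev n →ₗ[ℂ] ((Fin n → Bool) × Equiv.Perm (Fin n) × (Fin n → ℕ) → ℂ) :=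
    LinearMap.pi fun t =>
      MvPolynomial.lcoeff ℂ (Finsupp.equivFunOnFinite.symm t.2.2) ∘ₗ
      (φ t.1).restrictScalars ℂ ∘ₗ (LinearMap.proj t.2.1) ∘ₗ ev ∘ₗ (rep n).toLinearMap
  refine LinearIndependent.of_comp F ?_
  have : F ∘ basisFam n = fun t => Pi.single t (1 : ℂ) := by
    funext t u
    obtain ⟨a, σ, s⟩ := t
    obtain ⟨b, τ, r⟩ := u
    change MvPolynomial.coeff (Finsupp.equivFunOnFinite.symm r)
      (φ b ((rep n (basisFam n (a, σ, s)) (vac n)) τ)) = _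
    rw [rep_basisFam]
    simp only [Pi.smul_apply, map_smul]
    by_cases h1 : τ = σ
    · subst h1
      simp only [Pi.single_eq_same, hφ, List.mem_finRange]
      by_cases h2 : a = b
      · subst h2
        by_cases h3 : s = r
        · subst h3; simp
        · simp [MvPolynomial.coeff_monomial, h3, Ne.symm h3]
      · have h2' : ¬ ∀ p, a p = b p := fun h => h2 (funext h)
        simp [h2', Ne.symm h2]
    · simp [h1]
  rw [this]
  exact Pi.linearIndependent_single_one _ ℂ

/-! ### Spanning -/

theorem quotSergX (n : ℕ) : SergX n (Wq (n := n)) Cq Xq where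
  w_mul σ τ := by simpa [Wq] using RingQuot.mkAlgHom_rel ℂ (SGen.Rel.w_mul σ τ)
  w_one := by simpa [Wq] using RingQuot.mkAlgHom_rel ℂ (SGen.Rel.w_one (n := n))
  c_sq p := by simpa [Cq] using RingQuot.mkAlgHom_rel ℂ (SGen.Rel.c_sq p)
  c_anti p q h := by simpa [Cq] using RingQuot.mkAlgHom_rel ℂ (SGen.Rel.c_anticomm p q h)
  w_c σ p := by simpa [Cq, Wq] using RingQuot.mkAlgHom_rel ℂ (SGen.Rel.w_c σ p)
  x_w p q qs h h1 h2 := by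
    simpa [Xq, Wq] using RingQuot.mkAlgHom_rel ℂ (SGen.Rel.x_w p q qs h h1 h2)
  x_w_adj p ps h := by
    simpa [Xq, Wq, Cq] using RingQuot.mkAlgHom_rel ℂ (SGen.Rel.x_w_adj p ps h)
  x_c p q h := by simpa [Cq, Xq] using RingQuot.mkAlgHom_rel ℂ (SGen.Rel.x_c p q h)
  x_c_self p := by simpa [Cq, Xq] using RingQuot.mkAlgHom_rel ℂ (SGen.Rel.x_c_self p)

theorem Xq_comm {n : ℕ} (p q : Fin n) : Xq p * Xq q = Xq q * Xq p := by
  simpa [Xq] using RingQuot.mkAlgHom_rel ℂ (SGen.Rel.x_comm p q)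

/-- Clifford monomials in the algebra. -/
noncomputable def clA {n : ℕ} (l : List (Fin n)) (a : Fin n → Bool) : AffineSergeev n :=
  (l.map fun p => if a p then Cq p else 1).prod

/-- Polynomial monomials in the algebra. -/
noncomputable def xA {n : ℕ} (l : List (Fin n)) (s : Fin n → ℕ) : AffineSergeev n :=
  (l.map fun p => Xq p ^ s p).prod

/-- Span of the Clifford monomials. -/
noncomputable def spC {n : ℕ} (l : List (Fin n)) : Submodule ℂ (AffineSergeev n) :=
  Submodule.span ℂ (Set.range (clA l))

theorem clA_cons {n : ℕ} (q : Fin n) (l : List (Fin n)) (a : Fin n → Bool) :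
    clA (q :: l) a = (if a q then Cq q else 1) * clA l a := by simp [clA]

theorem clA_update {n : ℕ} (q : Fin n) (l : List (Fin n)) (hq : q ∉ l) (a : Fin n → Bool)
    (b : Bool) : clA l (Function.update a q b) = clA l a := by
  unfold clA
  congr 1
  refine List.map_congr_left fun p hp => ?_
  have : p ≠ q := by rintro rfl; exact hq hp
  rw [Function.update_of_ne this]

theorem mul_mem_of_span {A : Type*} [Ring A] [Algebra ℂ A] (y : A) (S : Set A)
    (N : Submodule ℂ A) (h : ∀ s ∈ S, y * s ∈ N) : ∀ x ∈ Submodule.span ℂ S, y * x ∈ N := by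
  intro x hx
  have : Submodule.span ℂ S ≤ N.comap (LinearMap.mulLeft ℂ y) := Submodule.span_le.2 h
  exact this hx

theorem negMulMem {A : Type*} [Ring A] [Algebra ℂ A] (a b : A) (N : Submodule ℂ A)
    (h : a * b ∈ N) : -a * b ∈ N := by
  rw [neg_mul]; exact N.neg_mem h

theorem spC_cons {n : ℕ} (q : Fin n) (l : List (Fin n)) (hq : q ∉ l) :
    ∀ y ∈ spC l, y ∈ spC (q :: l) ∧ Cq q * y ∈ spC (q :: l) := by
  intro y hy
  constructor
  · have := mul_mem_of_span 1 (Set.range (clA l)) (spC (q :: l)) ?_ y hy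
    · rwa [one_mul] at this
    · rintro _ ⟨a, rfl⟩
      refine Submodule.subset_span ⟨Function.update a q false, ?_⟩
      rw [clA_cons, clA_update _ _ hq]; simp
  · refine mul_mem_of_span _ (Set.range (clA l)) (spC (q :: l)) ?_ y hy
    rintro _ ⟨a, rfl⟩
    refine Submodule.subset_span ⟨Function.update a q true, ?_⟩
    rw [clA_cons, clA_update _ _ hq]; simp

theorem Cq_mul_spC {n : ℕ} (p : Fin n) (l : List (Fin n)) (hl : l.Nodup) (hp : p ∈ l) :
    ∀ y ∈ spC l, Cq p * y ∈ spC l := by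
  have H := quotSergX n
  induction l with
  | nil => simp at hp
  | cons q l ih =>
    rw [List.nodup_cons] at hl
    refine mul_mem_of_span _ _ _ ?_
    rintro _ ⟨a, rfl⟩
    have hm : clA l a ∈ spC l := Submodule.subset_span ⟨a, rfl⟩
    rw [clA_cons]
    by_cases hpq : p = q
    · subst hpq
      split_ifs
      · rw [← mul_assoc, H.c_sq]
        refine negMulMem _ _ _ ?_
        rw [one_mul]
        exact (spC_cons _ _ hl.1 _ hm).1
      · rw [one_mul]
        exact (spC_cons _ _ hl.1 _ hm).2
    · have hpl : p ∈ l := by simpa [hpq] using hp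
      have := ih hl.2 hpl _ hm
      split_ifs
      · rw [← mul_assoc, H.c_anti _ _ hpq]
        refine negMulMem _ _ _ ?_
        rw [mul_assoc]
        exact (spC_cons _ _ hl.1 _ this).2
      · rw [one_mul]
        exact (spC_cons _ _ hl.1 _ this).1

/-- The span of all Clifford monomials. -/
noncomputable def DC (n : ℕ) : Submodule ℂ (AffineSergeev n) := spC (List.finRange n)

/-- The span of the permutations. -/
noncomputable def DW (n : ℕ) : Submodule ℂ (AffineSergeev n) := Submodule.span ℂ (Set.range Wq)

/-- The span of the polynomial monomials. -/
noncomputable def DX (n : ℕ) : Submodule ℂ (AffineSergeev n) :=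
  Submodule.span ℂ (Set.range (xA (List.finRange n)))

/-- The span of one and the `x_p`. -/
noncomputable def DL (n : ℕ) : Submodule ℂ (AffineSergeev n) :=
  Submodule.span ℂ (insert 1 (Set.range Xq))

theorem Cq_DC {n : ℕ} (p : Fin n) : ∀ y ∈ DC n, Cq p * y ∈ DC n :=
  Cq_mul_spC p _ (List.nodup_finRange n) (List.mem_finRange p)

theorem one_DC {n : ℕ} : (1 : AffineSergeev n) ∈ DC n :=
  Submodule.subset_span ⟨fun _ => false, by simp [clA]⟩

theorem one_DL {n : ℕ} : (1 : AffineSergeev n) ∈ DL n :=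
  Submodule.subset_span (Set.mem_insert _ _)

theorem one_DX {n : ℕ} : (1 : AffineSergeev n) ∈ DX n :=
  Submodule.subset_span ⟨fun _ => 0, by simp [xA]⟩

theorem Wq_DW {n : ℕ} (τ : Equiv.Perm (Fin n)) : Wq τ ∈ DW n := Submodule.subset_span ⟨τ, rfl⟩

theorem one_DW {n : ℕ} : (1 : AffineSergeev n) ∈ DW n := by
  rw [← (quotSergX n).w_one]; exact Wq_DW _

theorem mul_mem_mul_of {A : Type*} [Ring A] [Algebra ℂ A] (y : A) (M N K : Submodule ℂ A)
    (h : ∀ m ∈ M, ∀ k ∈ N, y * (m * k) ∈ K) : ∀ x ∈ M * N, y * x ∈ K := by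
  intro x hx
  have : M * N ≤ K.comap (LinearMap.mulLeft ℂ y) := Submodule.mul_le.2 h
  exact this hx

theorem stab_mul {A : Type*} [Ring A] [Algebra ℂ A] (y : A) (M N : Submodule ℂ A)
    (h : ∀ m ∈ M, y * m ∈ M) : ∀ x ∈ M * N, y * x ∈ M * N := by
  refine mul_mem_mul_of _ _ _ _ fun m hm k hk => ?_
  rw [← mul_assoc]; exact Submodule.mul_mem_mul (h m hm) hk

theorem Cq_SH {n : ℕ} (p : Fin n) : ∀ y ∈ DC n * DW n, Cq p * y ∈ DC n * DW n :=
  stab_mul _ _ _ (Cq_DC p)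

theorem Wq_clA {n : ℕ} (τ : Equiv.Perm (Fin n)) (l : List (Fin n)) (a : Fin n → Bool) :
    ∃ y ∈ DC n, Wq τ * clA l a = y * Wq τ := by
  induction l with
  | nil => exact ⟨1, one_DC, by simp [clA]⟩
  | cons q l ih =>
    obtain ⟨y, hy, e⟩ := ih
    rw [clA_cons]
    split_ifs
    · exact ⟨Cq (τ q) * y, Cq_DC _ _ hy, by
        rw [← mul_assoc, (quotSergX n).w_c, mul_assoc, e, mul_assoc]⟩
    · exact ⟨y, hy, by rw [one_mul, e]⟩

theorem Wq_SH {n : ℕ} (τ : Equiv.Perm (Fin n)) : ∀ y ∈ DC n * DW n, Wq τ * y ∈ DC n * DW n := by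
  unfold DC DW spC
  rw [Submodule.span_mul_span]
  refine mul_mem_of_span _ _ _ ?_
  rintro _ ⟨_, ⟨a, rfl⟩, _, ⟨σ, rfl⟩, rfl⟩
  obtain ⟨y, hy, e⟩ := Wq_clA τ (List.finRange n) a
  change Wq τ * (clA (List.finRange n) a * Wq σ) ∈ _
  rw [← Submodule.span_mul_span, ← mul_assoc, e, mul_assoc, (quotSergX n).w_mul]
  exact Submodule.mul_mem_mul hy (Wq_DW _)

theorem Xq_SH {n : ℕ} (p : Fin n) : ∀ y ∈ DC n * DW n, Xq p * y ∈ DC n * DW n * DL n := by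
  have H := quotSergX n
  have hC : ∀ (p : Fin n), ∀ y ∈ DC n * DW n * DL n, Cq p * y ∈ DC n * DW n * DL n :=
    fun p => stab_mul _ _ _ (Cq_SH p)
  have hW : ∀ (τ : Equiv.Perm (Fin n)), ∀ y ∈ DC n * DW n * DL n, Wq τ * y ∈ DC n * DW n * DL n :=
    fun p => stab_mul _ _ _ (Wq_SH p)
  have hWU : ∀ σ : Equiv.Perm (Fin n), Wq σ ∈ DC n * DW n * DL n := by
    intro σ
    have := Submodule.mul_mem_mul (Submodule.mul_mem_mul one_DC (Wq_DW σ)) (one_DL (n := n))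
    rwa [one_mul, mul_one] at this
  have hXW : ∀ (σ : Equiv.Perm (Fin n)) (p : Fin n), Xq p * Wq σ ∈ DC n * DW n * DL n := by
    refine permAdjInduction n ?_ ?_
    · intro p
      rw [H.w_one, mul_one]
      have := Submodule.mul_mem_mul (Submodule.mul_mem_mul one_DC one_DW)
        (Submodule.subset_span (Set.mem_insert_of_mem 1 (Set.mem_range_self p)) : Xq p ∈ DL n)
      rwa [one_mul, one_mul] at this
    · intro i i' hi σ ih p
      rw [← H.w_mul, ← mul_assoc]
      by_cases h1 : p = i
      · subst h1
        rw [H.x_w_adj _ _ hi, sub_mul, sub_mul, one_mul, mul_assoc (Wq _), mul_assoc (Cq _)]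
        exact Submodule.sub_mem _ (Submodule.sub_mem _ (hW _ _ (ih _)) (hWU _))
          (hC _ _ (hC _ _ (hWU _)))
      by_cases h2 : p = i'
      · subst h2
        rw [H.x_w_adj' _ _ hi, sub_mul, add_mul, one_mul, mul_assoc (Wq _), mul_assoc (Cq _)]
        exact Submodule.sub_mem _ (Submodule.add_mem _ (hW _ _ (ih _)) (hWU _))
          (hC _ _ (hC _ _ (hWU _)))
      · rw [H.x_w _ _ _ hi h1 h2, mul_assoc (Wq _)]
        exact hW _ _ (ih _)
  have hl : ∀ (l : List (Fin n)) a σ, Xq p * (clA l a * Wq σ) ∈ DC n * DW n * DL n := by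
    intro l a σ
    induction l with
    | nil => simpa [clA] using hXW σ p
    | cons q l ih =>
      rw [clA_cons]
      split_ifs
      · rw [mul_assoc (Cq q), ← mul_assoc (Xq p)]
        by_cases hp : p = q
        · subst hp
          rw [H.x_c_self]
          refine negMulMem _ _ _ ?_
          rw [mul_assoc (Cq p)]
          exact hC _ _ ih
        · rw [H.x_c _ _ hp, mul_assoc (Cq q)]
          exact hC _ _ ih
      · rwa [one_mul]
  intro y hy
  unfold DC DW spC at hy
  rw [Submodule.span_mul_span] at hy
  refine mul_mem_of_span _ _ _ ?_ y hy
  rintro _ ⟨_, ⟨a, rfl⟩, _, ⟨σ, rfl⟩, rfl⟩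
  exact hl _ _ _

theorem Xq_xA {n : ℕ} (p : Fin n) (l : List (Fin n)) (hl : l.Nodup) (hp : p ∈ l) (s : Fin n → ℕ) :
    Xq p * xA l s = xA l (Function.update s p (s p + 1)) := by
  induction l with
  | nil => simp at hp
  | cons q l ih =>
    rw [List.nodup_cons] at hl
    have e : ∀ s, xA (q :: l) s = Xq q ^ s q * xA l s := by simp [xA]
    rw [e, e]
    by_cases hpq : p = q
    · subst hpq
      have : xA l (Function.update s p (s p + 1)) = xA l s := by
        unfold xA
        congr 1
        refine List.map_congr_left fun r hr => ?_
        have : r ≠ p := by rintro rfl; exact hl.1 hr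
        rw [Function.update_of_ne this]
      rw [this, Function.update_self, pow_succ', mul_assoc]
    · have hpl : p ∈ l := by simpa [hpq] using hp
      have hc : Commute (Xq p) (Xq q ^ s q) := Commute.pow_right (Xq_comm p q) _
      rw [← mul_assoc, hc.eq, mul_assoc, ih hl.2 hpl, Function.update_of_ne (Ne.symm hpq)]

theorem DL_DX (n : ℕ) : DL n * DX n ≤ DX n := by
  unfold DL DX
  rw [Submodule.span_mul_span, Submodule.span_le]
  rintro _ ⟨x, hx, _, ⟨s, rfl⟩, rfl⟩
  rcases hx with rfl | ⟨p, rfl⟩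
  · exact Submodule.subset_span ⟨s, by simp⟩
  · exact Submodule.subset_span ⟨_, (Xq_xA p _ (List.nodup_finRange n) (List.mem_finRange p) s).symm⟩

theorem basisFam_span (n : ℕ) : Submodule.span ℂ (Set.range (basisFam n)) = ⊤ := by
  have hT : DC n * DW n * DX n ≤ Submodule.span ℂ (Set.range (basisFam n)) := by
    unfold DC DW DX spC
    rw [Submodule.span_mul_span, Submodule.span_mul_span]
    apply Submodule.span_mono
    rintro _ ⟨_, ⟨_, ⟨a, rfl⟩, _, ⟨σ, rfl⟩, rfl⟩, _, ⟨s, rfl⟩, rfl⟩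
    exact ⟨(a, σ, s), rfl⟩
  rw [eq_top_iff]
  refine le_trans ?_ hT
  have hX : ∀ p : Fin n, ∀ y ∈ DC n * DW n * DX n, Xq p * y ∈ DC n * DW n * DX n := by
    intro p
    refine mul_mem_mul_of _ _ _ _ fun m hm k hk => ?_
    rw [← mul_assoc]
    have h1 := Submodule.mul_mem_mul (Xq_SH p m hm) hk
    rw [mul_assoc (DC n * DW n)] at h1
    exact Submodule.mul_le.2 (fun a ha b hb => Submodule.mul_mem_mul ha (DL_DX n hb)) h1
  have hall : ∀ f : SGen.F n, ∀ y ∈ DC n * DW n * DX n,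
      RingQuot.mkAlgHom ℂ (SGen.Rel n) f * y ∈ DC n * DW n * DX n := by
    intro f
    induction f using FreeAlgebra.induction with
    | grade0 r =>
      intro y hy
      rw [AlgHom.commutes, ← Algebra.smul_def]
      exact Submodule.smul_mem _ _ hy
    | grade1 x =>
      intro y hy
      cases x with
      | w σ => exact stab_mul _ _ _ (Wq_SH σ) y hy
      | c p => exact stab_mul _ _ _ (Cq_SH p) y hy
      | x p => exact hX p y hy
    | mul a b ha hb =>
      intro y hy
      rw [map_mul, mul_assoc (RingQuot.mkAlgHom ℂ (SGen.Rel n) a)]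
      exact ha _ (hb _ hy)
    | add a b ha hb =>
      intro y hy
      rw [map_add, add_mul]
      exact Submodule.add_mem _ (ha _ hy) (hb _ hy)
  intro z _
  obtain ⟨f, rfl⟩ := RingQuot.mkAlgHom_surjective ℂ (SGen.Rel n) z
  have h1 := Submodule.mul_mem_mul (Submodule.mul_mem_mul (one_DC (n := n)) one_DW) one_DX
  have := hall f _ h1
  rwa [one_mul, mul_one, mul_one] at this

/-- The products `Y x₁^{s₁}…x_n^{s_n}` (with `Y` running through a basis of `H_n` and
`s₁,…,s_n ≥ 0`) form a linear basis of the degenerate affine Sergeev algebra `A_n`. -/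
theorem affineSergeev_basis (n : ℕ) :
    LinearIndependent ℂ (basisFam n) ∧
      Submodule.span ℂ (Set.range (basisFam n)) = ⊤ := by
  exact ⟨basisFam_indep n, basisFam_span n⟩
end

section
/- Let b be a finite-dimensional Lie algebra with trivial centre and ω an involutive automorphism of b. Let h = { X(u) ∈ b[u] : ω(X(u)) = X(−u) } be the twisted polynomial current Lie algebra. Then the centre of the universal enveloping algebra U(h) is trivial (equal to ℂ·1). -/
open scoped TensorProduct

/-- The polynomial current Lie algebra `b[u]` is a Lie algebra over `ℂ`
(by restriction of scalars from `ℂ[u]`). -/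
noncomputable instance currentLieAlgebra (b : Type*) [LieRing b] [LieAlgebra ℂ b] :
    LieAlgebra ℂ (Polynomial ℂ ⊗[ℂ] b) :=
  { (inferInstance : Module ℂ (Polynomial ℂ ⊗[ℂ] b)) with
    lie_smul := fun t x y => by
      have h := lie_smul (R := Polynomial ℂ) (M := Polynomial ℂ ⊗[ℂ] b)
        (algebraMap ℂ (Polynomial ℂ) t) x y
      rw [← algebraMap_smul (Polynomial ℂ) t y, ← algebraMap_smul (Polynomial ℂ) t ⁅x, y⁆]
      exact h }


namespace TwCur
variable {L : Type*} [LieRing L] [LieAlgebra ℂ L]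

attribute [local instance] LieRing.ofAssociativeRing

local notation "U" => UniversalEnvelopingAlgebra ℂ

/-- The canonical map as a linear map. -/
noncomputable def iota (L : Type*) [LieRing L] [LieAlgebra ℂ L] : L →ₗ[ℂ] U L :=
  (UniversalEnvelopingAlgebra.ι ℂ : L →ₗ⁅ℂ⁆ U L)

theorem iota_lie (x y : L) : iota L ⁅x, y⁆ = iota L x * iota L y - iota L y * iota L x := by
  have := (UniversalEnvelopingAlgebra.ι ℂ : L →ₗ⁅ℂ⁆ U L).map_lie x y
  rw [LieRing.of_associative_ring_bracket] at this
  exact this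

/-- Coproduct. -/
noncomputable def comulL (L : Type*) [LieRing L] [LieAlgebra ℂ L] : L →ₗ⁅ℂ⁆ (U L ⊗[ℂ] U L) :=
  { toLinearMap := (TensorProduct.mk ℂ (U L) (U L)).flip 1 ∘ₗ iota L
      + (TensorProduct.mk ℂ (U L) (U L)) 1 ∘ₗ iota L
    map_lie' := by
      intro x y
      simp only [LieRing.of_associative_ring_bracket]
      simp [iota_lie, TensorProduct.tmul_sub, mul_add, add_mul]
      abel }

noncomputable def Delta (L : Type*) [LieRing L] [LieAlgebra ℂ L] : U L →ₐ[ℂ] (U L ⊗[ℂ] U L) :=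
  UniversalEnvelopingAlgebra.lift ℂ (comulL L)

theorem Delta_iota (x : L) : Delta L (iota L x) = iota L x ⊗ₜ 1 + 1 ⊗ₜ iota L x := by
  have := UniversalEnvelopingAlgebra.lift_ι_apply ℂ (comulL L) x
  exact this

/-- Augmentation. -/
noncomputable def eps (L : Type*) [LieRing L] [LieAlgebra ℂ L] : U L →ₐ[ℂ] ℂ :=
  UniversalEnvelopingAlgebra.lift ℂ (0 : L →ₗ⁅ℂ⁆ ℂ)

theorem eps_iota (x : L) : eps L (iota L x) = 0 :=
  UniversalEnvelopingAlgebra.lift_ι_apply ℂ (0 : L →ₗ⁅ℂ⁆ ℂ) x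

/-- Contraction of the coproduct with a functional. -/
noncomputable def con (ψ : U L →ₗ[ℂ] ℂ) : (U L ⊗[ℂ] U L) →ₗ[ℂ] U L :=
  (TensorProduct.lid ℂ (U L)).toLinearMap ∘ₗ ψ.rTensor (U L)

theorem con_tmul (ψ : U L →ₗ[ℂ] ℂ) (a b : U L) : con ψ (a ⊗ₜ b) = ψ a • b := by
  simp [con]

noncomputable def D (ψ : U L →ₗ[ℂ] ℂ) (z : U L) : U L := con ψ (Delta L z)

theorem D_add (ψ) (z w : U L) : D ψ (z + w) = D ψ z + D ψ w := by simp [D]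
theorem D_sub (ψ) (z w : U L) : D ψ (z - w) = D ψ z - D ψ w := by simp [D]
theorem D_smul (ψ) (c : ℂ) (z : U L) : D ψ (c • z) = c • D ψ z := by simp [D]
theorem D_one (ψ) : D ψ (1 : U L) = ψ 1 • 1 := by
  simp [D, Algebra.TensorProduct.one_def, con_tmul]
theorem add_D (ψ φ) (z : U L) : D (ψ + φ) z = D ψ z + D φ z := by
  simp [D, con, LinearMap.rTensor_add]
theorem sub_D (ψ φ) (z : U L) : D (ψ - φ) z = D ψ z - D φ z := by
  simp [D, con, LinearMap.rTensor_sub]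
theorem smul_D (c : ℂ) (ψ) (z : U L) : D (c • ψ) z = c • D ψ z := by
  simp [D, con, LinearMap.rTensor_smul]

theorem D_mul_left (ψ : U L →ₗ[ℂ] ℂ) (x : L) (w : U L) :
    D ψ (iota L x * w) = D (ψ ∘ₗ LinearMap.mulLeft ℂ (iota L x)) w + iota L x * D ψ w := by
  simp only [D, map_mul, Delta_iota, add_mul]
  induction Delta L w using TensorProduct.induction_on with
  | zero => simp
  | tmul a b => simp [con_tmul]
  | add a b ha hb =>
    simp only [map_add, mul_add] at *
    rw [add_add_add_comm, ha, hb]; abel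

theorem D_mul_right (ψ : U L →ₗ[ℂ] ℂ) (x : L) (w : U L) :
    D ψ (w * iota L x) = D (ψ ∘ₗ LinearMap.mulRight ℂ (iota L x)) w + D ψ w * iota L x := by
  simp only [D, map_mul, Delta_iota, mul_add]
  induction Delta L w using TensorProduct.induction_on with
  | zero => simp
  | tmul a b => simp [con_tmul]
  | add a b ha hb =>
    simp only [map_add, add_mul] at *
    rw [add_add_add_comm, ha, hb]; abel

/-- filtration by low elements -/
noncomputable def G (W : Submodule ℂ L) (n : ℕ) : Submodule ℂ (U L) :=
  (1 ⊔ W.map (iota L)) ^ n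

theorem G_mono {W W' : Submodule ℂ L} (h : W ≤ W') (n : ℕ) : G W n ≤ G W' n :=
  pow_le_pow_left' (sup_le_sup_left (Submodule.map_mono h) _) n

theorem G_le {W : Submodule ℂ L} {m n : ℕ} (h : m ≤ n) : G W m ≤ G W n :=
  pow_le_pow_right' le_sup_left h

theorem iota_mem {W : Submodule ℂ L} {x : L} (hx : x ∈ W) : iota L x ∈ G W 1 := by
  rw [G, pow_one]
  exact Submodule.mem_sup_right ⟨x, hx, rfl⟩

theorem G_mul {W : Submodule ℂ L} {m n : ℕ} {x y : U L} (hx : x ∈ G W m) (hy : y ∈ G W n) :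
    x * y ∈ G W (m + n) := by
  rw [G, pow_add]; exact Submodule.mul_mem_mul hx hy

theorem G_induction (W : Submodule ℂ L) (P : ℕ → U L → Prop)
    (h1 : P 0 1) (hadd : ∀ n z w, P n z → P n w → P n (z + w))
    (hsmul : ∀ n (c : ℂ) z, P n z → P n (c • z))
    (hstep : ∀ n z, z ∈ G W n → P n z → P (n + 1) z)
    (hmul : ∀ n x z, x ∈ W → z ∈ G W n → P n z → P (n + 1) (iota L x * z)) :
    ∀ n z, z ∈ G W n → P n z := by
  intro n
  induction n with
  | zero =>
    intro z hz
    rw [G, pow_zero] at hz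
    obtain ⟨c, rfl⟩ := Submodule.mem_one.1 hz
    rw [Algebra.algebraMap_eq_smul_one]
    exact hsmul _ _ _ h1
  | succ n ih =>
    intro z hz
    rw [G, pow_succ'] at hz
    refine Submodule.mul_induction_on hz ?_ (hadd _)
    intro m hm w hw
    obtain ⟨a, ha, y, hy, rfl⟩ := Submodule.mem_sup.1 hm
    obtain ⟨c, rfl⟩ := Submodule.mem_one.1 ha
    obtain ⟨x, hx, rfl⟩ := hy
    rw [add_mul, ← Algebra.smul_def]
    exact hadd _ _ _ (hsmul _ _ _ (hstep _ _ hw (ih _ hw))) (hmul _ _ _ hx hw (ih _ hw))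

/-- shifted filtration -/
noncomputable def F (L : Type*) [LieRing L] [LieAlgebra ℂ L] : ℕ → Submodule ℂ (U L)
  | 0 => ⊥
  | n + 1 => G ⊤ n

theorem F_le_succ (n : ℕ) : F L n ≤ F L (n + 1) := by
  cases n with
  | zero => exact bot_le
  | succ n => exact G_le (Nat.le_succ n)

theorem F_mul_left (x : L) {n : ℕ} {z : U L} (hz : z ∈ F L n) : iota L x * z ∈ F L (n + 1) := by
  cases n with
  | zero => rw [(Submodule.mem_bot ℂ).1 hz, mul_zero]; exact zero_mem _
  | succ n =>
    have := G_mul (iota_mem (Submodule.mem_top (x := x))) hz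
    rwa [add_comm] at this

theorem G_le_F (W : Submodule ℂ L) (n : ℕ) : G W n ≤ F L (n + 1) := G_mono le_top n

/-- lemma (d) -/
theorem comm_mem (a : L) {n : ℕ} {z : U L} (hz : z ∈ F L n) :
    iota L a * z - z * iota L a ∈ F L n := by
  cases n with
  | zero => rw [(Submodule.mem_bot ℂ).1 hz]; simp
  | succ n =>
    refine G_induction ⊤ (fun n z => iota L a * z - z * iota L a ∈ F L (n + 1)) ?_ ?_ ?_ ?_ ?_ n z hz
    · simp
    · intro n z w h1 h2
      convert add_mem h1 h2 using 1
      noncomm_ring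
    · intro n c z h
      convert Submodule.smul_mem _ c h using 1
      simp [smul_sub]
    · intro n z _ h
      exact F_le_succ _ h
    · intro n x z _ hz h
      have h1 := F_mul_left x h
      have h2 := F_mul_left ⁅a, x⁆ (n := n + 1) hz
      convert add_mem h1 h2 using 1
      rw [iota_lie]; noncomm_ring

/-- lemma (a) -/
theorem D_mem {n : ℕ} {z : U L} (hz : z ∈ F L (n + 1)) :
    ∀ ψ : U L →ₗ[ℂ] ℂ, D ψ z - ψ 1 • z ∈ F L n := by
  refine G_induction ⊤ (fun n z => ∀ ψ : U L →ₗ[ℂ] ℂ, D ψ z - ψ 1 • z ∈ F L n) ?_ ?_ ?_ ?_ ?_ n z hz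
  · intro ψ; simp [D_one]
  · intro n z w h1 h2 ψ
    convert add_mem (h1 ψ) (h2 ψ) using 1
    rw [D_add, smul_add]; abel
  · intro n c z h ψ
    convert Submodule.smul_mem _ c (h ψ) using 1
    rw [D_smul, smul_sub, smul_comm]
  · intro n z _ h ψ
    exact F_le_succ _ (h ψ)
  · intro n x z _ hz h ψ
    have h1 := F_mul_left x (h ψ)
    have h2 := F_le_succ _ (h (ψ ∘ₗ LinearMap.mulLeft ℂ (iota L x)))
    have h3 := (F L (n + 1)).smul_mem (ψ (iota L x)) hz
    convert add_mem (add_mem h1 h2) h3 using 1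
    simp [D_mul_left, mul_sub]; abel

/-- lemma (b) -/
theorem D_mem_of_vanish {W : Submodule ℂ L} {n : ℕ} {z : U L} (hz : z ∈ G W n)
    {ψ : U L →ₗ[ℂ] ℂ} (h1 : ψ 1 = 0) (hW : ∀ x ∈ W, ψ (iota L x) = 0) :
    D ψ z ∈ F L (n - 1) := by
  refine G_induction W (fun n z => D ψ z ∈ F L (n - 1)) ?_ ?_ ?_ ?_ ?_ n z hz
  · simp [D_one, h1]
  · intro n z w h1 h2
    rw [D_add]; exact add_mem h1 h2
  · intro n c z h
    rw [D_smul]; exact Submodule.smul_mem _ c h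
  · intro n z _ h
    cases n with
    | zero => exact h
    | succ n => exact F_le_succ _ h
  · intro n x z hx hz h
    rw [D_mul_left]
    simp only [Nat.add_sub_cancel]
    refine add_mem ?_ ?_
    · have := D_mem (G_le_F W n hz) (ψ ∘ₗ LinearMap.mulLeft ℂ (iota L x))
      simpa [hW x hx] using this
    · cases n with
      | zero =>
        have h0 : D ψ z = 0 := (Submodule.mem_bot ℂ).1 h
        rw [h0, mul_zero]; exact zero_mem _
      | succ n => exact F_mul_left x h

/-- lemma (c) -/
theorem euler {W : Submodule ℂ L} {ι : Type*} (s : Finset ι) (e : ι → L)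
    (ψ : ι → (U L →ₗ[ℂ] ℂ)) (h1 : ∀ i ∈ s, ψ i 1 = 0)
    (he : ∀ x ∈ W, ∑ i ∈ s, ψ i (iota L x) • e i = x) {n : ℕ} {z : U L} (hz : z ∈ G W n) :
    ∑ i ∈ s, iota L (e i) * D (ψ i) z - (n : ℂ) • z ∈ F L n := by
  refine G_induction W (fun n z => ∑ i ∈ s, iota L (e i) * D (ψ i) z - (n : ℂ) • z ∈ F L n)
    ?_ ?_ ?_ ?_ ?_ n z hz
  · rw [Finset.sum_eq_zero]
    · simp
    · intro i hi; simp [D_one, h1 i hi]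
  · intro n z w h1 h2
    convert add_mem h1 h2 using 1
    simp only [D_add, mul_add, Finset.sum_add_distrib, smul_add]; abel
  · intro n c z h
    convert Submodule.smul_mem _ c h using 1
    simp only [D_smul, mul_smul_comm, smul_sub, Finset.smul_sum]
    rw [smul_comm]
  · intro n z hz h
    convert sub_mem (F_le_succ _ h) (G_le_F W n hz) using 1
    push_cast
    rw [add_smul, one_smul]; abel
  · intro n x z hx hz h
    have hz' := G_le_F W n hz
    have A : ∑ i ∈ s, iota L (e i) * (D (ψ i ∘ₗ LinearMap.mulLeft ℂ (iota L x)) z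
        - ψ i (iota L x) • z) ∈ F L (n + 1) := by
      refine sum_mem fun i hi => F_mul_left _ ?_
      simpa using D_mem hz' (ψ i ∘ₗ LinearMap.mulLeft ℂ (iota L x))
    have B : ∑ i ∈ s, iota L ⁅e i, x⁆ * D (ψ i) z ∈ F L (n + 1) := by
      refine sum_mem fun i hi => F_mul_left _ ?_
      simpa [h1 i hi] using D_mem hz' (ψ i)
    have C := F_mul_left x h
    have E : ∑ i ∈ s, iota L (e i) * (ψ i (iota L x) • z) = iota L x * z := by
      conv_rhs => rw [← he x hx]
      simp [Finset.sum_mul]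
    simp only [mul_smul_comm] at E
    convert add_mem (add_mem A B) C using 1
    simp only [mul_sub, Finset.sum_sub_distrib, E, iota_lie, sub_mul, D_mul_left, mul_add,
      Finset.sum_add_distrib, Finset.mul_sum, mul_assoc, mul_smul_comm]
    push_cast
    rw [add_smul, one_smul]; abel

/-- Extension of functionals. -/
theorem exists_ext (hinj : Function.Injective (iota L)) :
    ∃ ext : (L →ₗ[ℂ] ℂ) →ₗ[ℂ] (U L →ₗ[ℂ] ℂ),
      (∀ f, ext f 1 = 0) ∧ ∀ f x, ext f (iota L x) = f x := by
  obtain ⟨p, hp⟩ := (iota L).exists_leftInverse_of_injective (LinearMap.ker_eq_bot.2 hinj)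
  let q : U L →ₗ[ℂ] L := p - (LinearMap.toSpanSingleton ℂ L (p 1)) ∘ₗ (eps L).toLinearMap
  refine ⟨LinearMap.lcomp ℂ ℂ q, fun f => ?_, fun f x => ?_⟩
  · simp [q]
  · have := LinearMap.congr_fun hp x
    simp only [LinearMap.comp_apply, LinearMap.id_apply] at this
    simp [q, eps_iota, this]

theorem central_D (z : U L) (hz : ∀ w, w * z = z * w) (ψ : U L →ₗ[ℂ] ℂ) (a : L) :
    D (ψ ∘ₗ (LinearMap.mulLeft ℂ (iota L a) - LinearMap.mulRight ℂ (iota L a))) z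
      = - (iota L a * D ψ z - D ψ z * iota L a) := by
  have h1 := D_mul_left ψ a z
  have h2 := D_mul_right ψ a z
  rw [hz, h2] at h1
  rw [LinearMap.comp_sub, sub_D]
  rw [← sub_eq_zero] at h1 ⊢
  rw [← neg_eq_zero, ← h1]
  abel

theorem exists_mem_G (W : ℕ → Submodule ℂ L) (hW : Monotone W) (hWt : ∀ x, ∃ n, x ∈ W n)
    (z : U L) : ∃ N n, z ∈ G (W N) n := by
  let S : Subalgebra ℂ (U L) :=
    { carrier := {z | ∃ N n, z ∈ G (W N) n}
      mul_mem' := by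
        rintro a b ⟨N, n, h⟩ ⟨M, m, h'⟩
        exact ⟨max N M, n + m, G_mul (G_mono (hW (le_max_left _ _)) _ h)
          (G_mono (hW (le_max_right _ _)) _ h')⟩
      add_mem' := by
        rintro a b ⟨N, n, h⟩ ⟨M, m, h'⟩
        exact ⟨max N M, max n m, add_mem (G_le (le_max_left _ _) (G_mono (hW (le_max_left _ _)) _ h))
          (G_le (le_max_right _ _) (G_mono (hW (le_max_right _ _)) _ h'))⟩
      algebraMap_mem' := by
        intro c
        refine ⟨0, 0, ?_⟩
        rw [G, pow_zero]
        exact Submodule.mem_one.2 ⟨c, rfl⟩ }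
  have hS : ∀ x, iota L x ∈ S := by
    intro x
    obtain ⟨n, hn⟩ := hWt x
    exact ⟨n, 1, iota_mem hn⟩
  let j : L →ₗ⁅ℂ⁆ S :=
    { toLinearMap := (iota L).codRestrict S.toSubmodule hS
      map_lie' := by
        intro x y
        apply Subtype.ext
        exact iota_lie x y }
  have key : S.val.comp (UniversalEnvelopingAlgebra.lift ℂ j) = AlgHom.id ℂ (U L) := by
    apply UniversalEnvelopingAlgebra.hom_ext
    ext x
    simp only [LieHom.comp_apply, AlgHom.coe_toLieHom]
    simp
    rfl
  have := DFunLike.congr_fun key z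
  simp only [AlgHom.comp_apply, AlgHom.id_apply] at this
  have h2 := (UniversalEnvelopingAlgebra.lift ℂ j z).2
  change S.val _ ∈ S at h2
  rw [this] at h2
  exact h2

end TwCur

namespace TwCur
variable {b : Type*} [LieRing b] [LieAlgebra ℂ b]

attribute [local instance] LieRing.ofAssociativeRing

/-- The coefficient of `u^k`. -/
noncomputable def cf (b : Type*) [LieRing b] [LieAlgebra ℂ b] (k : ℕ) :
    (Polynomial ℂ ⊗[ℂ] b) →ₗ[ℂ] b :=
  (TensorProduct.lid ℂ b).toLinearMap ∘ₗ (Polynomial.lcoeff ℂ k).rTensor b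

theorem cf_tmul (k : ℕ) (p : Polynomial ℂ) (X : b) : cf b k (p ⊗ₜ X) = p.coeff k • X := by
  simp [cf]

theorem cf_bound (x : Polynomial ℂ ⊗[ℂ] b) : ∃ N, ∀ k, N < k → cf b k x = 0 := by
  induction x using TensorProduct.induction_on with
  | zero => exact ⟨0, by simp⟩
  | tmul p X =>
    refine ⟨p.natDegree, fun k hk => ?_⟩
    rw [cf_tmul, Polynomial.coeff_eq_zero_of_natDegree_lt hk, zero_smul]
  | add x y hx hy =>
    obtain ⟨N, hN⟩ := hx
    obtain ⟨M, hM⟩ := hy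
    refine ⟨max N M, fun k hk => ?_⟩
    rw [map_add, hN k (lt_of_le_of_lt (le_max_left _ _) hk),
      hM k (lt_of_le_of_lt (le_max_right _ _) hk), add_zero]

theorem cf_sum_aux (x : Polynomial ℂ ⊗[ℂ] b) : ∃ N, ∀ M, N ≤ M →
    ∑ k ∈ Finset.range (M + 1), (Polynomial.X ^ k : Polynomial ℂ) ⊗ₜ[ℂ] cf b k x = x := by
  induction x using TensorProduct.induction_on with
  | zero => exact ⟨0, by simp⟩
  | tmul p X =>
    refine ⟨p.natDegree, fun M hM => ?_⟩
    simp_rw [cf_tmul, ← TensorProduct.smul_tmul, ← TensorProduct.sum_tmul]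
    congr 1
    conv_rhs => rw [p.as_sum_range' (M + 1) (by omega)]
    simp [← Polynomial.C_mul_X_pow_eq_monomial, Polynomial.smul_eq_C_mul]
  | add x y hx hy =>
    obtain ⟨N, hN⟩ := hx
    obtain ⟨M, hM⟩ := hy
    refine ⟨max N M, fun k hk => ?_⟩
    simp only [map_add, TensorProduct.tmul_add, Finset.sum_add_distrib]
    rw [hN k (le_trans (le_max_left _ _) hk), hM k (le_trans (le_max_right _ _) hk)]

theorem cf_sum (x : Polynomial ℂ ⊗[ℂ] b) (N : ℕ) (hN : ∀ k, N < k → cf b k x = 0) :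
    ∑ k ∈ Finset.range (N + 1), (Polynomial.X ^ k : Polynomial ℂ) ⊗ₜ[ℂ] cf b k x = x := by
  obtain ⟨M, hM⟩ := cf_sum_aux x
  rw [← hM (max M N) (le_max_left _ _)]
  conv_lhs => rw [hM (max M N) (le_max_left _ _)]
  refine Finset.sum_subset (fun k hk => ?_) (fun k _ hk => ?_)
  · simp only [Finset.mem_range] at *; omega
  · simp only [Finset.mem_range] at *
    rw [hN k (by omega), TensorProduct.tmul_zero]

theorem cf_lie (r k : ℕ) (X : b) (x : Polynomial ℂ ⊗[ℂ] b) :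
    cf b (r + k) ⁅(Polynomial.X ^ r : Polynomial ℂ) ⊗ₜ[ℂ] X, x⁆ = ⁅X, cf b k x⁆ := by
  induction x using TensorProduct.induction_on with
  | zero =>
    have := lie_zero (L := Polynomial ℂ ⊗[ℂ] b) (M := Polynomial ℂ ⊗[ℂ] b)
      ((Polynomial.X ^ r : Polynomial ℂ) ⊗ₜ[ℂ] X)
    rw [map_zero, lie_zero]
    exact (congrArg (cf b (r + k)) this).trans (map_zero _)
  | tmul p Y =>
    rw [LieAlgebra.ExtendScalars.bracket_tmul, cf_tmul, cf_tmul, add_comm,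
      Polynomial.coeff_X_pow_mul, lie_smul]
  | add x y hx hy =>
    have := lie_add (L := Polynomial ℂ ⊗[ℂ] b) (M := Polynomial ℂ ⊗[ℂ] b)
      ((Polynomial.X ^ r : Polynomial ℂ) ⊗ₜ[ℂ] X) x y
    rw [map_add, lie_add, ← hx, ← hy, ← map_add]
    exact congrArg (cf b (r + k)) this

theorem center_zero (hc : LieAlgebra.center ℂ b = ⊥) (Y : b) (h : ∀ X : b, ⁅X, Y⁆ = 0) : Y = 0 := by
  have : Y ∈ LieAlgebra.center ℂ b := (LieModule.mem_maxTrivSubmodule ℂ b b Y).2 h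
  rw [hc] at this
  simpa using this

theorem iota_injective (hc : LieAlgebra.center ℂ b = ⊥)
    (h : LieSubalgebra ℂ (Polynomial ℂ ⊗[ℂ] b)) : Function.Injective (iota h) := by
  rw [← LinearMap.ker_eq_bot, LinearMap.ker_eq_bot']
  intro x hx
  let ρ : h →ₗ⁅ℂ⁆ Module.End ℂ (Polynomial ℂ ⊗[ℂ] b) :=
    (LieAlgebra.ad ℂ (Polynomial ℂ ⊗[ℂ] b)).comp h.incl
  have h1 : UniversalEnvelopingAlgebra.lift ℂ ρ (iota h x) = ρ x :=
    UniversalEnvelopingAlgebra.lift_ι_apply ℂ ρ x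
  rw [hx, map_zero] at h1
  have h2 : ∀ y : Polynomial ℂ ⊗[ℂ] b, ⁅(x : Polynomial ℂ ⊗[ℂ] b), y⁆ = 0 := fun y =>
    (LinearMap.congr_fun h1 y).symm
  have h3 : ∀ k, cf b k (x : Polynomial ℂ ⊗[ℂ] b) = 0 := by
    intro k
    refine center_zero hc _ fun X => ?_
    rw [← cf_lie 0 k X, ← lie_skew, h2, neg_zero, map_zero]
  apply Subtype.ext
  rw [← cf_sum (x : Polynomial ℂ ⊗[ℂ] b) 0 (fun k _ => h3 k)]
  simp [h3]

/-- Elements of degree at most `N`. -/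
noncomputable def low (h : LieSubalgebra ℂ (Polynomial ℂ ⊗[ℂ] b)) (N : ℕ) : Submodule ℂ h where
  carrier := {x | ∀ k, N < k → cf b k (x : Polynomial ℂ ⊗[ℂ] b) = 0}
  add_mem' := by
    intro x y hx hy k hk
    simp [hx k hk, hy k hk]
  zero_mem' := by intro k _; simp
  smul_mem' := by
    intro c x hx k hk
    simp [hx k hk]

theorem low_mono (h : LieSubalgebra ℂ (Polynomial ℂ ⊗[ℂ] b)) : Monotone (low h) :=
  fun _ _ hNM _ hx k hk => hx k (lt_of_le_of_lt hNM hk)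

theorem dual_top [FiniteDimensional ℂ b] (hc : LieAlgebra.center ℂ b = ⊥)
    (S : Submodule ℂ (b →ₗ[ℂ] ℂ))
    (hS : ∀ (φ : b →ₗ[ℂ] ℂ) (X : b), φ ∘ₗ (LieAlgebra.ad ℂ b X : b →ₗ[ℂ] b) ∈ S) : S = ⊤ := by
  have hS' : (Submodule.dualCoannihilator (R := ℂ) (M := b) S) = ⊥ := by
    rw [eq_bot_iff]
    intro Y hY
    rw [Submodule.mem_dualCoannihilator] at hY
    refine center_zero hc Y fun X => ?_
    rw [← Module.forall_dual_apply_eq_zero_iff ℂ]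
    intro φ
    exact hY _ (hS φ X)
  have := Subspace.dualCoannihilator_dualAnnihilator_eq (K := ℂ) (V := b) (W := S)
  rw [← this, hS', Submodule.dualAnnihilator_bot]

theorem exists_low (h : LieSubalgebra ℂ (Polynomial ℂ ⊗[ℂ] b)) (n : ℕ)
    (z : UniversalEnvelopingAlgebra ℂ h) (hz : z ∈ G (⊤ : Submodule ℂ h) n) :
    ∃ N, z ∈ G (low h N) n := by
  refine G_induction ⊤ (fun n z => ∃ N, z ∈ G (low h N) n) ?_ ?_ ?_ ?_ ?_ n z hz
  · exact ⟨0, by rw [G, pow_zero]; exact Submodule.one_le.1 le_rfl⟩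
  · rintro n z w ⟨N, hN⟩ ⟨M, hM⟩
    exact ⟨max N M, add_mem (G_mono (low_mono h (le_max_left _ _)) _ hN)
      (G_mono (low_mono h (le_max_right _ _)) _ hM)⟩
  · rintro n c z ⟨N, hN⟩
    exact ⟨N, Submodule.smul_mem _ _ hN⟩
  · rintro n z _ ⟨N, hN⟩
    exact ⟨N, G_le (Nat.le_succ n) hN⟩
  · rintro n x z _ _ ⟨N, hN⟩
    obtain ⟨M, hM⟩ := cf_bound (x : Polynomial ℂ ⊗[ℂ] b)
    have hx : x ∈ low h M := hM
    refine ⟨max N M, ?_⟩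
    rw [add_comm n 1]
    exact G_mul (iota_mem (low_mono h (le_max_right _ _) hx))
      (G_mono (low_mono h (le_max_left _ _)) _ hN)

/-- The functional on `h` given by a coefficient followed by a functional on `b`. -/
noncomputable def fn (h : LieSubalgebra ℂ (Polynomial ℂ ⊗[ℂ] b)) (k : ℕ) (φ : b →ₗ[ℂ] ℂ) :
    h →ₗ[ℂ] ℂ := φ ∘ₗ cf b k ∘ₗ h.toSubmodule.subtype

theorem fn_apply (h : LieSubalgebra ℂ (Polynomial ℂ ⊗[ℂ] b)) (k : ℕ) (φ : b →ₗ[ℂ] ℂ) (x : h) :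
    fn h k φ x = φ (cf b k (x : Polynomial ℂ ⊗[ℂ] b)) := rfl

theorem key_step (h : LieSubalgebra ℂ (Polynomial ℂ ⊗[ℂ] b))
    (ext : (h →ₗ[ℂ] ℂ) →ₗ[ℂ] (UniversalEnvelopingAlgebra ℂ h →ₗ[ℂ] ℂ))
    (ext1 : ∀ f, ext f 1 = 0) (ext2 : ∀ f x, ext f (iota h x) = f x)
    (z : UniversalEnvelopingAlgebra ℂ h) (hz : ∀ w, w * z = z * w)
    (n N : ℕ) (hn : z ∈ G (low h N) (n + 1)) (r k : ℕ) (hr : N < r) (X : b)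
    (ha : (Polynomial.X ^ r : Polynomial ℂ) ⊗ₜ[ℂ] X ∈ h) (φ : b →ₗ[ℂ] ℂ) :
    D (ext (fn h k (φ ∘ₗ (LieAlgebra.ad ℂ b X : b →ₗ[ℂ] b)))) z ∈ F h n := by
  set a : h := ⟨_, ha⟩ with ha'
  have h1 : D (ext (fn h (r + k) φ)) z ∈ F h n := by
    refine D_mem_of_vanish hn (ext1 _) ?_
    intro x hx
    rw [ext2, fn_apply, hx (r + k) (by omega), map_zero]
  have h2 := central_D z hz (ext (fn h (r + k) φ)) a
  have h3 := neg_mem (comm_mem a h1)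
  rw [← h2] at h3
  have h4 : D (ext (fn h k (φ ∘ₗ (LieAlgebra.ad ℂ b X : b →ₗ[ℂ] b))) -
      (ext (fn h (r + k) φ)) ∘ₗ
        (LinearMap.mulLeft ℂ (iota h a) - LinearMap.mulRight ℂ (iota h a))) z ∈ F h n := by
    refine D_mem_of_vanish hn ?_ ?_
    · simp [ext1]
    · intro x _
      rw [LinearMap.sub_apply, LinearMap.comp_apply, LinearMap.sub_apply,
        LinearMap.mulLeft_apply, LinearMap.mulRight_apply, ← iota_lie, ext2, ext2, fn_apply,
        fn_apply, sub_eq_zero, LinearMap.comp_apply, LieAlgebra.ad_apply, ← cf_lie r k X]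
      rfl
  rw [sub_D] at h4
  simpa using add_mem h4 h3

theorem main_step [FiniteDimensional ℂ b]
    (hcentre : LieAlgebra.center ℂ b = ⊥)
    (ω : b →ₗ⁅ℂ⁆ b) (hω : ∀ X : b, ω (ω X) = X)
    (T : (Polynomial ℂ ⊗[ℂ] b) →ₗ[ℂ] (Polynomial ℂ ⊗[ℂ] b))
    (hT : ∀ (p : Polynomial ℂ) (X : b),
      T (p ⊗ₜ[ℂ] X) = (p.comp (-Polynomial.X)) ⊗ₜ[ℂ] (ω X))
    (h : LieSubalgebra ℂ (Polynomial ℂ ⊗[ℂ] b))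
    (hh : ∀ z : Polynomial ℂ ⊗[ℂ] b, z ∈ h ↔ T z = z)
    (z : UniversalEnvelopingAlgebra ℂ h) (hz : ∀ w, w * z = z * w)
    (n : ℕ) (hn : z ∈ F h (n + 2)) : z ∈ F h (n + 1) := by
  obtain ⟨ext, ext1, ext2⟩ := exists_ext (iota_injective hcentre h)
  obtain ⟨N, hN⟩ := exists_low h (n + 1) z hn
  have hall : ∀ (k : ℕ) (φ : b →ₗ[ℂ] ℂ), D (ext (fn h k φ)) z ∈ F h n := by
    intro k
    let S : Submodule ℂ (b →ₗ[ℂ] ℂ) :=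
      { carrier := {φ | D (ext (fn h k φ)) z ∈ F h n}
        add_mem' := by
          intro f g hf hg
          have : fn h k (f + g) = fn h k f + fn h k g := rfl
          simp only [Set.mem_ofPred_eq] at *
          rw [this, map_add, add_D]
          exact add_mem hf hg
        zero_mem' := by
          have : fn h k 0 = (0 : ℂ) • fn h k 0 := by rw [zero_smul]; rfl
          simp only [Set.mem_ofPred_eq]
          rw [this, map_smul, smul_D, zero_smul]
          exact zero_mem _
        smul_mem' := by
          intro c f hf
          have : fn h k (c • f) = c • fn h k f := rfl
          simp only [Set.mem_ofPred_eq] at *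
          rw [this, map_smul, smul_D]
          exact Submodule.smul_mem _ _ hf }
    have hS : S = ⊤ := by
      apply dual_top hcentre
      intro φ X
      have hplus : φ ∘ₗ (LieAlgebra.ad ℂ b (X + ω X) : b →ₗ[ℂ] b) ∈ S := by
        refine key_step h ext ext1 ext2 z hz n N hN (2 * (N + 1)) k (by omega) _ ?_ φ
        rw [hh, hT, map_add, hω, add_comm (ω X)]
        simp [pow_mul]
      have hminus : φ ∘ₗ (LieAlgebra.ad ℂ b (X - ω X) : b →ₗ[ℂ] b) ∈ S := by
        refine key_step h ext ext1 ext2 z hz n N hN (2 * (N + 1) + 1) k (by omega) _ ?_ φ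
        rw [hh, hT, map_sub, hω, ← neg_sub X, TensorProduct.tmul_neg, ← TensorProduct.neg_tmul]
        simp [pow_mul, pow_succ]
      have := S.smul_mem (1 / 2 : ℂ) (S.add_mem hplus hminus)
      convert this using 1
      ext Y
      simp
      ring
    intro φ
    have : φ ∈ S := by rw [hS]; trivial
    exact this
  have hTT : ∀ y, T (T y) = y := by
    intro y
    induction y using TensorProduct.induction_on with
    | zero => simp
    | tmul p X => simp [hT, hω, Polynomial.comp_assoc]
    | add x y hx hy => rw [map_add, map_add, hx, hy]
  let π : (Polynomial ℂ ⊗[ℂ] b) →ₗ[ℂ] h :=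
    ((1 / 2 : ℂ) • (LinearMap.id + T)).codRestrict h.toSubmodule (by
      intro y
      change _ ∈ h
      rw [hh]
      simp [hTT, add_comm])
  have hπ : ∀ x : h, π x = x := by
    intro x
    apply Subtype.ext
    change (1 / 2 : ℂ) • ((x : Polynomial ℂ ⊗[ℂ] b) + T x) = x
    rw [(hh _).1 x.2, ← two_smul ℂ, smul_smul]
    norm_num
  let B := Module.finBasis ℂ b
  have E := euler (W := low h N) (Finset.range (N + 1) ×ˢ Finset.univ)
    (fun i => π ((Polynomial.X ^ i.1 : Polynomial ℂ) ⊗ₜ[ℂ] B i.2))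
    (fun i => ext (fn h i.1 (B.coord i.2))) (fun i _ => ext1 _) (by
      intro x hx
      simp only [ext2, fn_apply, ← map_smul, ← map_sum, Finset.sum_product]
      conv_rhs => rw [← hπ x, ← cf_sum (x : Polynomial ℂ ⊗[ℂ] b) N hx]
      congr 1
      refine Finset.sum_congr rfl fun k _ => ?_
      conv_rhs => rw [← B.sum_repr (cf b k (x : Polynomial ℂ ⊗[ℂ] b)), TensorProduct.tmul_sum]
      simp) hN
  have E0 : ∑ i ∈ Finset.range (N + 1) ×ˢ (Finset.univ : Finset (Fin (Module.finrank ℂ b))),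
      iota h (π ((Polynomial.X ^ i.1 : Polynomial ℂ) ⊗ₜ[ℂ] B i.2)) *
        D (ext (fn h i.1 (B.coord i.2))) z ∈ F h (n + 1) :=
    sum_mem (fun i _ => F_mul_left _ (hall i.1 (B.coord i.2)))
  have E2 := sub_mem E0 E
  rw [sub_sub_cancel] at E2
  have E3 := Submodule.smul_mem _ ((n + 1 : ℕ) : ℂ)⁻¹ E2
  rwa [smul_smul, inv_mul_cancel₀ (by exact_mod_cast Nat.succ_ne_zero n), one_smul] at E3

theorem main [FiniteDimensional ℂ b]
    (hcentre : LieAlgebra.center ℂ b = ⊥)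
    (ω : b →ₗ⁅ℂ⁆ b) (hω : ∀ X : b, ω (ω X) = X)
    (T : (Polynomial ℂ ⊗[ℂ] b) →ₗ[ℂ] (Polynomial ℂ ⊗[ℂ] b))
    (hT : ∀ (p : Polynomial ℂ) (X : b),
      T (p ⊗ₜ[ℂ] X) = (p.comp (-Polynomial.X)) ⊗ₜ[ℂ] (ω X))
    (h : LieSubalgebra ℂ (Polynomial ℂ ⊗[ℂ] b))
    (hh : ∀ z : Polynomial ℂ ⊗[ℂ] b, z ∈ h ↔ T z = z) :
    Subalgebra.center ℂ (UniversalEnvelopingAlgebra ℂ h) = ⊥ := by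
  rw [eq_bot_iff]
  intro z hz
  rw [Subalgebra.mem_center_iff] at hz
  obtain ⟨N, n, hn⟩ := exists_mem_G (low h) (low_mono h)
    (fun x => cf_bound (x : Polynomial ℂ ⊗[ℂ] b)) z
  have hn' := G_le_F _ n hn
  have : z ∈ F h 1 := by
    clear hn
    induction n with
    | zero => exact hn'
    | succ n ih => exact ih (main_step hcentre ω hω T hT h hh z hz n hn')
  change z ∈ G ⊤ 0 at this
  rw [G, pow_zero] at this
  obtain ⟨c, hc⟩ := Submodule.mem_one.1 this
  exact Algebra.mem_bot.2 ⟨c, hc⟩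

end TwCur

/-- Let `b` be a finite-dimensional complex Lie algebra with trivial centre and `ω` an
involutive automorphism of `b`.  Let `h = { X(u) ∈ b[u] : ω(X(u)) = X(-u) }` be the
twisted polynomial current Lie algebra, realised as the Lie subalgebra of
`b[u] = ℂ[u] ⊗[ℂ] b` consisting of the fixed points of the map
`T : p(u) ⊗ X ↦ p(-u) ⊗ ω(X)`.  Then the centre of the universal enveloping algebra
`U(h)` is trivial, i.e. reduces to `ℂ·1`. -/
theorem center_of_UEA_of_twisted_current_trivial
    (b : Type*) [LieRing b] [LieAlgebra ℂ b] [FiniteDimensional ℂ b]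
    (hcentre : LieAlgebra.center ℂ b = ⊥)
    (ω : b →ₗ⁅ℂ⁆ b) (hω : ∀ X : b, ω (ω X) = X)
    (T : (Polynomial ℂ ⊗[ℂ] b) →ₗ[ℂ] (Polynomial ℂ ⊗[ℂ] b))
    (hT : ∀ (p : Polynomial ℂ) (X : b),
      T (p ⊗ₜ[ℂ] X) = (p.comp (-Polynomial.X)) ⊗ₜ[ℂ] (ω X))
    (h : LieSubalgebra ℂ (Polynomial ℂ ⊗[ℂ] b))
    (hh : ∀ z : Polynomial ℂ ⊗[ℂ] b, z ∈ h ↔ T z = z) :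
    Subalgebra.center ℂ (UniversalEnvelopingAlgebra ℂ h) = ⊥ := by
  exact TwCur.main hcentre ω hω T hT h hh
end
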